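/- arXiv:2106.07320 — 2 statements merged into one kernel-verified Lean document; each statement's English description precedes it below -/
import Mathlib

section
/- Define the following elements of Aut(𝔠𝔥(n)): F_d(α) = blockdiag(1, αI_{2n−2}, α²) for α > 0; F_Sp(M) = blockdiag(1, M, 1) for M with MᵀJ_{n−1}M = J_{n−1}; and F_t(v,a) = [[1, 0, 0],[(1/2)J_{n−1}v, I_{2n−2}, 0],[a, vᵀ, 1]] for v ∈ ℝ^{2n−2}, a ∈ ℝ. Then an element F ∈ Aut(𝔠𝔥(n)) has positive lower-right entry λ if and only if F = F_d(α)·F_Sp(M)·F_t(v,a) for some (and then unique) α > 0, symplectic M, v ∈ ℝ^{2n−2} and a ∈ ℝ; moreover the set of such F is exactly the identity (connected) component Aut₀(𝔠𝔥(n)) of the matrix group Aut(𝔠𝔥(n)). -/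
noncomputable section

open Matrix BigOperators Finset

namespace CHn

/-- Structure constants of the Lie algebra 𝔠𝔥(n) in the ordered basis
`(X, Y_1, …, Y_{n-1}, Z_1, …, Z_{n-1}, W)`:
index `0 ↦ X`, indices `1,…,n-1 ↦ Y_1,…,Y_{n-1}`,
indices `n,…,2n-2 ↦ Z_1,…,Z_{n-1}`, index `2n-1 ↦ W`.
The nonzero brackets are `[X,Y_i] = (1/2)Y_i`, `[X,Z_i] = (1/2)Z_i`,
`[X,W] = W`, `[Z_j,Y_i] = δ_{ij} W`. -/
def structC (n : ℕ) (i j k : Fin (2 * n)) : ℝ :=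
  (if i.val = 0 ∧ j = k ∧ 1 ≤ j.val ∧ j.val ≤ 2 * n - 2 then (1 : ℝ) / 2 else 0)
  - (if j.val = 0 ∧ i = k ∧ 1 ≤ i.val ∧ i.val ≤ 2 * n - 2 then (1 : ℝ) / 2 else 0)
  + (if i.val = 0 ∧ j.val = 2 * n - 1 ∧ k.val = 2 * n - 1 then (1 : ℝ) else 0)
  - (if j.val = 0 ∧ i.val = 2 * n - 1 ∧ k.val = 2 * n - 1 then (1 : ℝ) else 0)
  + (if n ≤ i.val ∧ i.val ≤ 2 * n - 2 ∧ i.val = j.val + (n - 1) ∧ k.val = 2 * n - 1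
      then (1 : ℝ) else 0)
  - (if n ≤ j.val ∧ j.val ≤ 2 * n - 2 ∧ j.val = i.val + (n - 1) ∧ k.val = 2 * n - 1
      then (1 : ℝ) else 0)

/-- The Lie bracket of `𝔠𝔥(n)`, as a bilinear operation on coordinate vectors. -/
def bracket (n : ℕ) (u v : Fin (2 * n) → ℝ) : Fin (2 * n) → ℝ :=
  fun k => ∑ i, ∑ j, u i * v j * structC n i j k

/-- `F` is the matrix (in the ordered basis) of a Lie algebra automorphism of `𝔠𝔥(n)`. -/
def IsAut (n : ℕ) (F : Matrix (Fin (2 * n)) (Fin (2 * n)) ℝ) : Prop :=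
  IsUnit F ∧ ∀ u v, F.mulVec (bracket n u v) = bracket n (F.mulVec u) (F.mulVec v)

/-- The normal form `S(p, x, σ, β)`: the block matrix
`[[p, xᵀ, 0, 0], [x, σ, 0, 0], [0, 0, σ, 0], [0, 0, 0, β]]`
with blocks of sizes `1, n-1, n-1, 1`. -/
def Sform (n : ℕ) (p : ℝ) (x σ : Fin (n - 1) → ℝ) (β : ℝ) :
    Matrix (Fin (2 * n)) (Fin (2 * n)) ℝ := fun i j =>
  if i.val = 0 ∧ j.val = 0 then p
  else if h : i.val = 0 ∧ 1 ≤ j.val ∧ j.val ≤ n - 1 then x ⟨j.val - 1, by omega⟩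
  else if h : j.val = 0 ∧ 1 ≤ i.val ∧ i.val ≤ n - 1 then x ⟨i.val - 1, by omega⟩
  else if h : i = j ∧ 1 ≤ i.val ∧ i.val ≤ n - 1 then σ ⟨i.val - 1, by omega⟩
  else if h : i = j ∧ n ≤ i.val ∧ i.val ≤ 2 * n - 2 then σ ⟨i.val - n, by omega⟩
  else if i = j ∧ i.val = 2 * n - 1 then β
  else 0

/-- Admissibility of the parameters `(p, x, σ, β)`:
`p, β > 0`, all `x_i ≥ 0`, `σ_1 ≥ … ≥ σ_{n-2} ≥ 1` and the convention `σ_{n-1} = 1`. -/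
def Admissible (n : ℕ) (p : ℝ) (x σ : Fin (n - 1) → ℝ) (β : ℝ) : Prop :=
  0 < p ∧ 0 < β ∧ (∀ i, 0 ≤ x i) ∧ Antitone σ ∧ (∀ i, 1 ≤ σ i) ∧
    ∀ _h : 1 ≤ n - 1, σ ⟨n - 2, by omega⟩ = 1

/-- `z = p - Σ_i x_i² / σ_i`. -/
def zval (n : ℕ) (p : ℝ) (x σ : Fin (n - 1) → ℝ) : ℝ :=
  p - ∑ i, (x i) ^ 2 / σ i

/-- The inner product on `𝔠𝔥(n)` determined by a matrix `S`. -/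
def ip (n : ℕ) (S : Matrix (Fin (2 * n)) (Fin (2 * n)) ℝ) (u v : Fin (2 * n) → ℝ) : ℝ :=
  u ⬝ᵥ S.mulVec v

/-- The coordinates (w.r.t. the standard basis) of the Koszul form
`K(u,v)(T) = ⟨[u,v],T⟩ - ⟨[v,T],u⟩ + ⟨[T,u],v⟩`. -/
def koszul (n : ℕ) (S : Matrix (Fin (2 * n)) (Fin (2 * n)) ℝ)
    (u v : Fin (2 * n) → ℝ) : Fin (2 * n) → ℝ := fun t =>
  ip n S (bracket n u v) (Pi.single t 1) - ip n S (bracket n v (Pi.single t 1)) u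
    + ip n S (bracket n (Pi.single t 1) u) v

/-- The Levi-Civita product `∇_u v` of the inner product `S`,
i.e. the unique solution of the Koszul formula `2⟨∇_u v, T⟩ = K(u,v)(T)`
(for invertible symmetric `S`). -/
def nabla (n : ℕ) (S : Matrix (Fin (2 * n)) (Fin (2 * n)) ℝ)
    (u v : Fin (2 * n) → ℝ) : Fin (2 * n) → ℝ :=
  (2 : ℝ)⁻¹ • (S⁻¹).mulVec (koszul n S u v)

/-- The curvature operator `R(u,v)w = ∇_u∇_v w - ∇_v∇_u w - ∇_{[u,v]} w`. -/
def curv (n : ℕ) (S : Matrix (Fin (2 * n)) (Fin (2 * n)) ℝ)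
    (u v w : Fin (2 * n) → ℝ) : Fin (2 * n) → ℝ :=
  nabla n S u (nabla n S v w) - nabla n S v (nabla n S u w) - nabla n S (bracket n u v) w

/-- The Ricci form `Ric(u,v) = tr (T ↦ R(T,u)v)`. -/
def ricci (n : ℕ) (S : Matrix (Fin (2 * n)) (Fin (2 * n)) ℝ)
    (u v : Fin (2 * n) → ℝ) : ℝ :=
  ∑ t, curv n S (Pi.single t 1) u v t

/-- The scalar curvature `τ = Σ_{i,j} g^{ij} Ric(e_i, e_j)`. -/
def scalarCurv (n : ℕ) (S : Matrix (Fin (2 * n)) (Fin (2 * n)) ℝ) : ℝ :=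
  ∑ i, ∑ j, (S⁻¹) i j * ricci n S (Pi.single i 1) (Pi.single j 1)

/-- The wedge endomorphism `(u∧v)(w) = ⟨v,w⟩u - ⟨u,w⟩v`. -/
def wedge (n : ℕ) (S : Matrix (Fin (2 * n)) (Fin (2 * n)) ℝ)
    (u v : Fin (2 * n) → ℝ) : (Fin (2 * n) → ℝ) → (Fin (2 * n) → ℝ) :=
  fun w => ip n S v w • u - ip n S u w • v

/-- The standard symplectic matrix `J_m = [[0, I_m], [-I_m, 0]]`. -/
def Jmat (m : ℕ) : Matrix (Fin (2 * m)) (Fin (2 * m)) ℝ := fun i j =>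
  if j.val = i.val + m then 1 else if i.val = j.val + m then -1 else 0

/-- The block matrix `[[1, 0, 0], [u, M, 0], [a, vᵀ, λ]]`
with blocks of sizes `1, 2n-2, 1`. -/
def blockF (n : ℕ) (M : Matrix (Fin (2 * (n - 1))) (Fin (2 * (n - 1))) ℝ)
    (u v : Fin (2 * (n - 1)) → ℝ) (a lam : ℝ) :
    Matrix (Fin (2 * n)) (Fin (2 * n)) ℝ := fun i j =>
  if i.val = 0 then (if j.val = 0 then 1 else 0)
  else if h : 1 ≤ i.val ∧ i.val ≤ 2 * n - 2 then
    (if j.val = 0 then u ⟨i.val - 1, by omega⟩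
     else if h2 : 1 ≤ j.val ∧ j.val ≤ 2 * n - 2 then
       M ⟨i.val - 1, by omega⟩ ⟨j.val - 1, by omega⟩
     else 0)
  else
    (if j.val = 0 then a
     else if h2 : 1 ≤ j.val ∧ j.val ≤ 2 * n - 2 then v ⟨j.val - 1, by omega⟩
     else lam)

/-- The metric is Einstein: the Ricci form is proportional to the inner product. -/
def IsEinstein (n : ℕ) (S : Matrix (Fin (2 * n)) (Fin (2 * n)) ℝ) : Prop :=
  ∃ c : ℝ, ∀ u v, ricci n S u v = c * ip n S u v

end CHn

namespace CHn

/-- Diagonal automorphism `F_d(α) = blockdiag(1, αI, α²)`. -/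
def Fd (n : ℕ) (α : ℝ) : Matrix (Fin (2 * n)) (Fin (2 * n)) ℝ :=
  blockF n (α • (1 : Matrix (Fin (2 * (n - 1))) (Fin (2 * (n - 1))) ℝ)) 0 0 0 (α ^ 2)

/-- Symplectic automorphism `F_Sp(M) = blockdiag(1, M, 1)`. -/
def FSp (n : ℕ) (M : Matrix (Fin (2 * (n - 1))) (Fin (2 * (n - 1))) ℝ) :
    Matrix (Fin (2 * n)) (Fin (2 * n)) ℝ :=
  blockF n M 0 0 0 1

/-- Generalized translation `F_t(v,a) = [[1,0,0],[(1/2)J v, I, 0],[a, vᵀ, 1]]`. -/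
def Ft (n : ℕ) (v : Fin (2 * (n - 1)) → ℝ) (a : ℝ) :
    Matrix (Fin (2 * n)) (Fin (2 * n)) ℝ :=
  blockF n 1 ((2 : ℝ)⁻¹ • (Jmat (n - 1)).mulVec v) v a 1

/-- `M` is joined to `1` by a path of symplectic matrices. -/
def SpC {l : Type} [Fintype l] [DecidableEq l] (M : Matrix (l ⊕ l) (l ⊕ l) ℝ) : Prop :=
  ∃ γ : ℝ → Matrix (l ⊕ l) (l ⊕ l) ℝ, Continuous γ ∧ (∀ t, γ t ∈ Matrix.symplecticGroup l ℝ) ∧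
    γ 0 = 1 ∧ γ 1 = M

section Sp
variable {l : Type} [Fintype l] [DecidableEq l]

lemma SpC.mul {M N : Matrix (l ⊕ l) (l ⊕ l) ℝ} (hM : SpC M) (hN : SpC N) : SpC (M * N) := by
  obtain ⟨γ, h1, h2, h3, h4⟩ := hM
  obtain ⟨δ, k1, k2, k3, k4⟩ := hN
  exact ⟨fun t => γ t * δ t, h1.mul k1, fun t => mul_mem (h2 t) (k2 t), by simp [h3, k3],
    by simp [h4, k4]⟩

lemma SpC.upper {X : Matrix l l ℝ} (hX : Xᵀ = X) : SpC (fromBlocks 1 X 0 1) := by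
  refine ⟨fun t => fromBlocks 1 (t • X) 0 1, ?_, fun t => ?_, by simp, by simp⟩
  · exact Continuous.matrix_fromBlocks continuous_const (by fun_prop) continuous_const
      continuous_const
  · rw [SymplecticGroup.fromBlocks_mem_iff]
    simp [hX]

lemma SpC.lower {X : Matrix l l ℝ} (hX : Xᵀ = X) : SpC (fromBlocks 1 0 X 1) := by
  refine ⟨fun t => fromBlocks 1 0 (t • X) 1, ?_, fun t => ?_, by simp, by simp⟩
  · exact Continuous.matrix_fromBlocks continuous_const continuous_const (by fun_prop)
      continuous_const
  · rw [SymplecticGroup.fromBlocks_mem_iff]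
    simp [hX]

lemma SpC.weyl {X Y : Matrix l l ℝ} (hX : Xᵀ = X) (hY : Yᵀ = Y) (h : X * Y = 1) :
    SpC (fromBlocks 0 X (-Y) 0) := by
  have h' : Y * X = 1 := mul_eq_one_comm.mp h
  have := ((SpC.upper hX).mul (SpC.lower (X := -Y) (by simp [hY]))).mul (SpC.upper hX)
  simpa [fromBlocks_multiply, h, h'] using this

lemma SpC.symm {X Y : Matrix l l ℝ} (hX : Xᵀ = X) (hY : Yᵀ = Y) (h : X * Y = 1) :
    SpC (fromBlocks X 0 0 Y) := by
  have := (SpC.weyl hX hY h).mul (SpC.weyl (l := l) (X := -1) (Y := -1) (by simp) (by simp)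
    (by simp))
  simpa [fromBlocks_multiply] using this

lemma SpC.gl (A : Matrix l l ℝ) (hA : A.det ≠ 0) :
    ∃ B, A * B = 1 ∧ SpC (fromBlocks A 0 0 Bᵀ) := by
  refine diagonal_transvection_induction_of_det_ne_zero
    (fun A => ∃ B, A * B = 1 ∧ SpC (fromBlocks A 0 0 Bᵀ)) A hA ?_ ?_ ?_
  · intro D hD
    have hD' : ∀ i, D i ≠ 0 := by
      intro i
      rw [det_diagonal] at hD
      exact fun h => hD (Finset.prod_eq_zero (Finset.mem_univ i) h)
    have h1 : diagonal D * diagonal (fun i => (D i)⁻¹) = 1 := by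
      rw [diagonal_mul_diagonal]
      simp [hD']
    refine ⟨diagonal (fun i => (D i)⁻¹), h1, ?_⟩
    rw [diagonal_transpose]
    exact SpC.symm (by simp) (by simp) h1
  · intro t
    have key : ∀ c : ℝ, transvection t.i t.j c * transvection t.i t.j (-c) = 1 := by
      intro c
      rw [transvection_mul_transvection_same _ _ t.hij]
      simp
    refine ⟨transvection t.i t.j (-t.c), key t.c,
      fun s => fromBlocks (transvection t.i t.j (s * t.c)) 0 0
        (transvection t.i t.j (-(s * t.c)))ᵀ, ?_, fun s => ?_, by simp,
        by simp [TransvectionStruct.toMatrix]⟩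
    · have hc : ∀ f : ℝ → ℝ, Continuous f → Continuous fun s => transvection t.i t.j (f s) := by
        intro f hf
        unfold transvection
        refine continuous_const.add ?_
        refine continuous_matrix fun a b => ?_
        simp only [single_apply]
        split_ifs <;> fun_prop
      exact Continuous.matrix_fromBlocks (hc _ (by fun_prop)) continuous_const continuous_const
        (hc _ (by fun_prop)).matrix_transpose
    · rw [SymplecticGroup.fromBlocks_mem_iff]
      refine ⟨by simp, by simp, ?_⟩
      rw [← transpose_mul, mul_eq_one_comm.mp (key _)]
      simp
  · rintro A B hA hB ⟨A', h1, h2⟩ ⟨B', h3, h4⟩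
    refine ⟨B' * A', ?_, ?_⟩
    · rw [Matrix.mul_assoc, ← Matrix.mul_assoc B, h3, Matrix.one_mul, h1]
    · have := h2.mul h4
      simpa [fromBlocks_multiply] using this

lemma exists_shift {A B C D : Matrix l l ℝ}
    (h : fromBlocks A B C D ∈ Matrix.symplecticGroup l ℝ) : ∃ t : ℝ, (A + t • C).det ≠ 0 := by
  by_contra! hc
  obtain ⟨e1, e2, e3⟩ := SymplecticGroup.fromBlocks_mem_iff.mp h
  set P : Matrix l l (Polynomial ℝ) := A.map Polynomial.C + (Polynomial.X : Polynomial ℝ) • C.map Polynomial.C with hP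
  have hp : P.det = 0 := by
    apply Polynomial.funext
    intro t
    have := hc t
    rw [← Polynomial.coe_evalRingHom, RingHom.map_det]
    simp only [map_zero]
    rw [← this]
    congr 1
    ext i j
    simp [hP]; exact mul_comm _ _
  have hI : (A.map Complex.ofRealHom + Complex.I • C.map Complex.ofRealHom).det = 0 := by
    have := congrArg (Polynomial.eval₂RingHom Complex.ofRealHom Complex.I) hp
    rw [RingHom.map_det, map_zero] at this
    rw [← this]
    congr 1
    ext i j
    simp [hP]; exact mul_comm _ _
  have hG : (Aᵀ * A + Cᵀ * C).map Complex.ofRealHom =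
      (Aᵀ.map Complex.ofRealHom - Complex.I • Cᵀ.map Complex.ofRealHom) *
      (A.map Complex.ofRealHom + Complex.I • C.map Complex.ofRealHom) := by
    have e1' := congrArg (fun M => Matrix.map M Complex.ofRealHom) e1
    simp only [Matrix.map_mul] at e1'
    have hadd : (Aᵀ * A + Cᵀ * C).map Complex.ofRealHom =
      (Aᵀ * A).map Complex.ofRealHom + (Cᵀ * C).map Complex.ofRealHom := by
      ext i j; simp only [map_apply, Matrix.add_apply, map_add]
    rw [hadd, Matrix.map_mul, Matrix.map_mul, sub_mul, mul_add, mul_add]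
    simp only [Matrix.smul_mul, Matrix.mul_smul, smul_smul, e1', Complex.I_mul_I]
    simp only [neg_smul, one_smul]
    abel
  have hdet : (Aᵀ * A + Cᵀ * C).det = 0 := by
    have := congrArg Matrix.det hG
    rw [det_mul, hI, mul_zero, ← RingHom.mapMatrix_apply, ← RingHom.map_det] at this
    simpa using this
  obtain ⟨x, hx, hx0⟩ := Matrix.exists_mulVec_eq_zero_iff.mpr hdet
  have h1 : A *ᵥ x ⬝ᵥ A *ᵥ x + C *ᵥ x ⬝ᵥ C *ᵥ x = 0 := by
    have := congrArg (fun y => x ⬝ᵥ y) hx0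
    simp only [add_mulVec, dotProduct_add, dotProduct_zero, ← mulVec_mulVec] at this
    rw [dotProduct_mulVec x, dotProduct_mulVec x, vecMul_transpose, vecMul_transpose] at this
    exact this
  have n1 : 0 ≤ A *ᵥ x ⬝ᵥ A *ᵥ x := Finset.sum_nonneg fun i _ => mul_self_nonneg _
  have n2 : 0 ≤ C *ᵥ x ⬝ᵥ C *ᵥ x := Finset.sum_nonneg fun i _ => mul_self_nonneg _
  have hA : A *ᵥ x = 0 := dotProduct_self_eq_zero.mp (by linarith)
  have hC : C *ᵥ x = 0 := dotProduct_self_eq_zero.mp (by linarith)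
  have e4 : Dᵀ * A - Bᵀ * C = 1 := by
    have := congrArg transpose e3
    simpa using this
  apply hx
  have := congrArg (fun M => M *ᵥ x) e4
  simpa [sub_mulVec, ← mulVec_mulVec, hA, hC] using this.symm

lemma spC_of_mem (M : Matrix (l ⊕ l) (l ⊕ l) ℝ) (hM : M ∈ Matrix.symplecticGroup l ℝ) :
    SpC M := by
  -- first the case of an invertible upper left block
  have main : ∀ A B C D : Matrix l l ℝ, fromBlocks A B C D ∈ Matrix.symplecticGroup l ℝ →
      A.det ≠ 0 → SpC (fromBlocks A B C D) := by
    intro A B C D h hA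
    obtain ⟨e1, e2, e3⟩ := SymplecticGroup.fromBlocks_mem_iff.mp h
    obtain ⟨E, hE, hS⟩ := SpC.gl A hA
    have hE' : E * A = 1 := mul_eq_one_comm.mp hE
    have hEt : Eᵀ * Aᵀ = 1 := by rw [← transpose_mul, hE, transpose_one]
    have hEt' : Aᵀ * Eᵀ = 1 := by rw [← transpose_mul, hE', transpose_one]
    have s1 : (C * E)ᵀ = C * E := by
      calc (C * E)ᵀ = Eᵀ * (Cᵀ * A) * E := by
            rw [transpose_mul, Matrix.mul_assoc, Matrix.mul_assoc, hE, Matrix.mul_one]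
        _ = (Eᵀ * Aᵀ) * C * E := by rw [← e1]; simp only [Matrix.mul_assoc]
        _ = C * E := by rw [hEt, Matrix.one_mul]
    have hD : D = Eᵀ + C * E * B := by
      have : Eᵀ * (Aᵀ * D - Cᵀ * B) = Eᵀ := by rw [e3, Matrix.mul_one]
      rw [Matrix.mul_sub, ← Matrix.mul_assoc, hEt, Matrix.one_mul, ← Matrix.mul_assoc,
        ← transpose_mul, s1] at this
      rw [← this]; abel
    have s2 : (E * B)ᵀ = E * B := by
      have q : Bᵀ * Eᵀ = E * B + (Bᵀ * C * E * B - Bᵀ * C * E * B) := by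
        have h5 : Bᵀ * D = Bᵀ * Eᵀ + Bᵀ * C * E * B := by
          rw [hD, Matrix.mul_add]; simp only [Matrix.mul_assoc]
        have h6 : Dᵀ * B = E * B + Bᵀ * C * E * B := by
          rw [hD, transpose_add, transpose_mul, s1, transpose_transpose, Matrix.add_mul]
          simp only [Matrix.mul_assoc]
        rw [h5, h6] at e2
        rw [sub_self, add_zero]
        exact add_right_cancel e2
      rw [transpose_mul, q]; simp
    have := ((SpC.lower s1).mul hS).mul (SpC.upper s2)
    have e : fromBlocks A B C D = fromBlocks 1 0 (C * E) 1 * fromBlocks A 0 0 Eᵀ *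
        fromBlocks 1 (E * B) 0 1 := by
      have c1 : A * (E * B) = B := by rw [← Matrix.mul_assoc, hE, Matrix.one_mul]
      have c2 : C * E * A = C := by rw [Matrix.mul_assoc, hE', Matrix.mul_one]
      simp [fromBlocks_multiply, c1, c2, hD]
      simp only [← Matrix.mul_assoc]
      abel
    rw [e]; exact this
  obtain ⟨A, B, C, D, rfl⟩ : ∃ A B C D, M = fromBlocks A B C D :=
    ⟨_, _, _, _, (fromBlocks_toBlocks M).symm⟩
  obtain ⟨t, ht⟩ := exists_shift hM
  have hu : SpC (fromBlocks 1 (t • (1 : Matrix l l ℝ)) 0 1) := SpC.upper (by simp)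
  have hu' : SpC (fromBlocks 1 ((-t) • (1 : Matrix l l ℝ)) 0 1) := SpC.upper (by simp)
  have hmem : fromBlocks 1 (t • (1 : Matrix l l ℝ)) 0 1 ∈ Matrix.symplecticGroup l ℝ := by
    obtain ⟨γ, _, h2, _, h4⟩ := hu
    rw [← h4]; exact h2 1
  have hprod := mul_mem hmem hM
  have e1 : fromBlocks 1 (t • (1 : Matrix l l ℝ)) 0 1 * fromBlocks A B C D =
    fromBlocks (A + t • C) (B + t • D) C D := by simp [fromBlocks_multiply]
  rw [e1] at hprod
  have := hu'.mul (main _ _ _ _ hprod ht)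
  have e2 : fromBlocks 1 ((-t) • (1 : Matrix l l ℝ)) 0 1 *
    fromBlocks (A + t • C) (B + t • D) C D = fromBlocks A B C D := by
    simp [fromBlocks_multiply]
  rwa [e2] at this
end Sp

lemma Jmat_path (m : ℕ) (M : Matrix (Fin (2 * m)) (Fin (2 * m)) ℝ)
    (hM : Mᵀ * Jmat m * M = Jmat m) :
    ∃ γ : ℝ → Matrix (Fin (2 * m)) (Fin (2 * m)) ℝ, Continuous γ ∧
      (∀ t, (γ t)ᵀ * Jmat m * γ t = Jmat m) ∧ γ 0 = 1 ∧ γ 1 = M := by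
  let e : Fin m ⊕ Fin m ≃ Fin (2 * m) := finSumFinEquiv.trans (finCongr (by omega))
  have hJ : (Jmat m).submatrix e e = - Matrix.J (Fin m) ℝ := by
    ext i j
    rcases i with i | i <;> rcases j with j | j <;>
      simp [e, Jmat, Matrix.J, Matrix.one_apply, Fin.ext_iff] <;>
      (try split_ifs) <;> first | rfl | omega | simp
  have hJ' : Jmat m = (- Matrix.J (Fin m) ℝ).submatrix e.symm e.symm := by
    rw [← hJ]; simp
  have h1 : M.submatrix e e ∈ Matrix.symplecticGroup (Fin m) ℝ := by
    rw [SymplecticGroup.mem_iff']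
    have := congrArg (fun N => N.submatrix e e) hM
    simp only [← submatrix_mul_equiv _ _ e e e, hJ] at this
    simpa using this
  obtain ⟨γ, c, h, h0, h1⟩ := spC_of_mem _ h1
  refine ⟨fun t => (γ t).submatrix e.symm e.symm, c.matrix_submatrix _ _, fun t => ?_, ?_, ?_⟩
  · have := SymplecticGroup.mem_iff'.mp (h t)
    rw [hJ', transpose_submatrix, submatrix_mul_equiv, submatrix_mul_equiv]
    simp [this]
  · simp [h0]
  · simp [h1]

section Aut
/-- indices of the `Y`s and `Z`s -/
def mi (n : ℕ) (i : Fin (2 * (n - 1))) : Fin (2 * n) := ⟨i.val + 1, by omega⟩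

variable (n : ℕ) (hn : 2 ≤ n)

/-- index of `X` -/
def zi : Fin (2 * n) := ⟨0, by omega⟩
lemma li_lt (n : ℕ) (hn : 2 ≤ n) : 2 * n - 1 < 2 * n := by omega

/-- index of `W` -/
def li : Fin (2 * n) := ⟨2 * n - 1, li_lt n hn⟩

lemma ru {A B : Matrix (Fin (2 * n)) (Fin (2 * n)) ℝ} (h : A * B = 1) : IsUnit A :=
  (Matrix.isUnit_iff_isUnit_det A).mpr (Matrix.isUnit_det_of_right_inverse h)

lemma idx_cases (i : Fin (2 * n)) : i = zi n hn ∨ (∃ k, i = mi n k) ∨ i = li n hn := by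
  by_cases h0 : i.val = 0
  · exact Or.inl (Fin.ext h0)
  by_cases h1 : i.val = 2 * n - 1
  · exact Or.inr (Or.inr (Fin.ext h1))
  · refine Or.inr (Or.inl ⟨⟨i.val - 1, by omega⟩, Fin.ext ?_⟩)
    simp only [mi]; omega

lemma sum_split (f : Fin (2 * n) → ℝ) :
    ∑ i, f i = f (zi n hn) + ∑ i, f (mi n i) + f (li n hn) := by
  have h : 2 * n = (2 * (n - 1) + 1) + 1 := by omega
  rw [← (finCongr h).symm.sum_comp, Fin.sum_univ_castSucc, Fin.sum_univ_succ]
  have e1 : (finCongr h).symm (Fin.last (2 * (n - 1) + 1)) = li n hn := by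
    refine Fin.ext ?_
    simp [li]; omega
  rw [e1]
  rfl

lemma mi_inj {i j : Fin (2 * (n - 1))} : mi n i = mi n j ↔ i = j := by
  simp [mi, Fin.ext_iff]

lemma zi_ne_mi (i) : zi n hn ≠ mi n i := by simp [zi, mi, Fin.ext_iff]
lemma mi_ne_zi (i) : mi n i ≠ zi n hn := by simp [zi, mi, Fin.ext_iff]
lemma zi_ne_li : zi n hn ≠ li n hn := by simp [zi, li, Fin.ext_iff]; omega
lemma li_ne_zi : li n hn ≠ zi n hn := by simp [zi, li, Fin.ext_iff]; omega
lemma mi_ne_li (i) : mi n i ≠ li n hn := by simp [mi, li, Fin.ext_iff]; omega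
lemma li_ne_mi (i) : li n hn ≠ mi n i := by simp [mi, li, Fin.ext_iff]; omega

/-- structure constants in terms of natural numbers -/
def SN (n a b c : ℕ) : ℝ :=
  (if a = 0 ∧ b = c ∧ 1 ≤ b ∧ b ≤ 2 * n - 2 then (1 : ℝ) / 2 else 0)
  - (if b = 0 ∧ a = c ∧ 1 ≤ a ∧ a ≤ 2 * n - 2 then (1 : ℝ) / 2 else 0)
  + (if a = 0 ∧ b = 2 * n - 1 ∧ c = 2 * n - 1 then (1 : ℝ) else 0)
  - (if b = 0 ∧ a = 2 * n - 1 ∧ c = 2 * n - 1 then (1 : ℝ) else 0)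
  + (if n ≤ a ∧ a ≤ 2 * n - 2 ∧ a = b + (n - 1) ∧ c = 2 * n - 1 then (1 : ℝ) else 0)
  - (if n ≤ b ∧ b ≤ 2 * n - 2 ∧ b = a + (n - 1) ∧ c = 2 * n - 1 then (1 : ℝ) else 0)

lemma structC_SN (i j k : Fin (2 * n)) : structC n i j k = SN n i.val j.val k.val := by
  simp only [structC, SN, Fin.ext_iff]

lemma bracket_z (u v : Fin (2 * n) → ℝ) : bracket n u v (zi n hn) = 0 := by
  have : ∀ i j, structC n i j (zi n hn) = 0 := by
    intro i j
    rw [structC_SN]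
    show SN n i.val j.val 0 = 0
    rw [SN, if_neg (by omega), if_neg (by omega), if_neg (by omega), if_neg (by omega),
      if_neg (by omega), if_neg (by omega)]
    norm_num
  simp [bracket, this]

lemma bracket_m (u v : Fin (2 * n) → ℝ) (k) : bracket n u v (mi n k) =
    (1 / 2) * (u (zi n hn) * v (mi n k) - v (zi n hn) * u (mi n k)) := by
  have : ∀ i j, structC n i j (mi n k) = (if i = zi n hn then (if j = mi n k then 1 / 2 else 0)
      else 0) - (if j = zi n hn then (if i = mi n k then 1 / 2 else 0) else 0) := by
    intro i j
    have hk := k.2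
    rw [structC_SN, ← ite_and, ← ite_and]
    simp only [Fin.ext_iff]
    show SN n i.val j.val (k.val + 1) =
      (if i.val = 0 ∧ j.val = k.val + 1 then 1 / 2 else 0) -
      (if j.val = 0 ∧ i.val = k.val + 1 then 1 / 2 else 0)
    generalize i.val = a
    generalize j.val = b
    have q1 : (a = 0 ∧ b = k.val + 1 ∧ 1 ≤ b ∧ b ≤ 2 * n - 2) ↔ (a = 0 ∧ b = k.val + 1) := by
      omega
    have q2 : (b = 0 ∧ a = k.val + 1 ∧ 1 ≤ a ∧ a ≤ 2 * n - 2) ↔ (b = 0 ∧ a = k.val + 1) := by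
      omega
    have q : ¬ (k.val + 1 = 2 * n - 1) := by omega
    simp only [SN, q1, q2, q, and_false, if_false, add_zero, sub_zero]
  simp only [bracket, this, mul_sub, Finset.sum_sub_distrib, mul_ite, mul_zero]
  simp
  ring

lemma bracket_l (u v : Fin (2 * n) → ℝ) : bracket n u v (li n hn) =
    u (zi n hn) * v (li n hn) - v (zi n hn) * u (li n hn)
     - (fun i => u (mi n i)) ⬝ᵥ (Jmat (n - 1)) *ᵥ (fun i => v (mi n i)) := by
  have e1 : structC n (zi n hn) (zi n hn) (li n hn) = 0 := by
    rw [structC_SN]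
    show SN n 0 0 (2 * n - 1) = 0
    rw [SN, if_neg (by omega), if_neg (by omega), if_neg (by omega)]
    norm_num
  have e2 : ∀ i, structC n (zi n hn) (mi n i) (li n hn) = 0 := by
    intro i
    have hi := i.2
    rw [structC_SN]
    show SN n 0 (i.val + 1) (2 * n - 1) = 0
    rw [SN, if_neg (by omega), if_neg (by omega), if_neg (by omega),
      if_neg (by omega), if_neg (by omega), if_neg (by omega)]
    norm_num
  have e3 : structC n (zi n hn) (li n hn) (li n hn) = 1 := by
    rw [structC_SN]
    show SN n 0 (2 * n - 1) (2 * n - 1) = 1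
    rw [SN, if_neg (by omega), if_neg (by omega), if_pos (by omega),
      if_neg (by omega), if_neg (by omega), if_neg (by omega)]
    norm_num
  have e4 : ∀ i, structC n (mi n i) (zi n hn) (li n hn) = 0 := by
    intro i
    have hi := i.2
    rw [structC_SN]
    show SN n (i.val + 1) 0 (2 * n - 1) = 0
    rw [SN, if_neg (by omega), if_neg (by omega), if_neg (by omega),
      if_neg (by omega), if_neg (by omega), if_neg (by omega)]
    norm_num
  have e5 : ∀ i j, structC n (mi n i) (mi n j) (li n hn) = - Jmat (n - 1) i j := by
    intro i j
    have hi := i.2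
    have hj := j.2
    rw [structC_SN]
    show SN n (i.val + 1) (j.val + 1) (2 * n - 1) = _
    unfold Jmat
    by_cases c1 : j.val = i.val + (n - 1)
    · rw [SN, if_neg (by omega), if_neg (by omega), if_neg (by omega), if_neg (by omega),
        if_neg (by omega), if_pos (by omega), if_pos (by omega)]
      norm_num
    by_cases c2 : i.val = j.val + (n - 1)
    · rw [SN, if_neg (by omega), if_neg (by omega), if_neg (by omega), if_neg (by omega),
        if_pos (by omega), if_neg (by omega), if_neg (by omega), if_pos (by omega)]
      norm_num
    · rw [SN, if_neg (by omega), if_neg (by omega), if_neg (by omega), if_neg (by omega),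
        if_neg (by omega), if_neg (by omega), if_neg (by omega), if_neg (by omega)]
      norm_num
  have e6 : ∀ i, structC n (mi n i) (li n hn) (li n hn) = 0 := by
    intro i
    have hi := i.2
    rw [structC_SN]
    show SN n (i.val + 1) (2 * n - 1) (2 * n - 1) = 0
    rw [SN, if_neg (by omega), if_neg (by omega), if_neg (by omega),
      if_neg (by omega), if_neg (by omega), if_neg (by omega)]
    norm_num
  have e7 : structC n (li n hn) (zi n hn) (li n hn) = -1 := by
    rw [structC_SN]
    show SN n (2 * n - 1) 0 (2 * n - 1) = -1
    rw [SN, if_neg (by omega), if_neg (by omega), if_neg (by omega),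
      if_pos (by omega), if_neg (by omega), if_neg (by omega)]
    norm_num
  have e8 : ∀ i, structC n (li n hn) (mi n i) (li n hn) = 0 := by
    intro i
    have hi := i.2
    rw [structC_SN]
    show SN n (2 * n - 1) (i.val + 1) (2 * n - 1) = 0
    rw [SN, if_neg (by omega), if_neg (by omega), if_neg (by omega),
      if_neg (by omega), if_neg (by omega), if_neg (by omega)]
    norm_num
  have e9 : structC n (li n hn) (li n hn) (li n hn) = 0 := by
    rw [structC_SN]
    show SN n (2 * n - 1) (2 * n - 1) (2 * n - 1) = 0
    rw [SN, if_neg (by omega), if_neg (by omega), if_neg (by omega)]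
    norm_num
  simp only [bracket, sum_split n hn, e1, e2, e3, e4, e5, e6, e7, e8, e9, mul_zero,
    Finset.sum_const_zero, dotProduct, mulVec, Finset.mul_sum, add_zero, zero_add, mul_one, mul_neg,
    Finset.sum_neg_distrib]
  have : ∀ i j, u (mi n i) * v (mi n j) * Jmat (n - 1) i j =
    u (mi n i) * (Jmat (n - 1) i j * v (mi n j)) := fun i j => by ring
  simp only [this]
  ring

section blk
variable (M : Matrix (Fin (2 * (n - 1))) (Fin (2 * (n - 1))) ℝ)
    (u v : Fin (2 * (n - 1)) → ℝ) (a lam : ℝ)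

lemma blk_zz : blockF n M u v a lam (zi n hn) (zi n hn) = 1 := by simp [blockF, zi]
lemma blk_zm (j) : blockF n M u v a lam (zi n hn) (mi n j) = 0 := by simp [blockF, zi, mi]
lemma blk_zl : blockF n M u v a lam (zi n hn) (li n hn) = 0 := by
  have h2 : 2 * n - 1 ≠ 0 := by omega
  simp [blockF, zi, li, h2]
lemma blk_mz (i) : blockF n M u v a lam (mi n i) (zi n hn) = u i := by
  have : i.val + 1 ≤ 2 * n - 2 := by omega
  simp [blockF, zi, mi, this]
lemma blk_mm (i j) : blockF n M u v a lam (mi n i) (mi n j) = M i j := by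
  have : i.val + 1 ≤ 2 * n - 2 := by omega
  have : j.val + 1 ≤ 2 * n - 2 := by omega
  simp [blockF, mi, *]
lemma blk_ml (i) : blockF n M u v a lam (mi n i) (li n hn) = 0 := by
  have h1 : i.val + 1 ≤ 2 * n - 2 := by omega
  have h2 : 2 * n - 1 ≠ 0 := by omega
  have h3 : ¬ (2 * n - 1 ≤ 2 * n - 2) := by omega
  simp [blockF, mi, li, h1, h2, h3]
lemma blk_lz : blockF n M u v a lam (li n hn) (zi n hn) = a := by
  have h2 : 2 * n - 1 ≠ 0 := by omega
  have h3 : ¬ (2 * n - 1 ≤ 2 * n - 2) := by omega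
  simp [blockF, zi, li, h2, h3]
lemma blk_lm (j) : blockF n M u v a lam (li n hn) (mi n j) = v j := by
  have h1 : j.val + 1 ≤ 2 * n - 2 := by omega
  have h2 : 2 * n - 1 ≠ 0 := by omega
  have h3 : ¬ (2 * n - 1 ≤ 2 * n - 2) := by omega
  simp [blockF, mi, li, h1, h2, h3]
lemma blk_ll : blockF n M u v a lam (li n hn) (li n hn) = lam := by
  have h2 : 2 * n - 1 ≠ 0 := by omega
  have h3 : ¬ (2 * n - 1 ≤ 2 * n - 2) := by omega
  simp [blockF, li, h2, h3]
end blk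

include hn in
lemma blk_ext {F G : Matrix (Fin (2 * n)) (Fin (2 * n)) ℝ}
    (h1 : F (zi n hn) (zi n hn) = G (zi n hn) (zi n hn))
    (h2 : ∀ j, F (zi n hn) (mi n j) = G (zi n hn) (mi n j))
    (h3 : F (zi n hn) (li n hn) = G (zi n hn) (li n hn))
    (h4 : ∀ i, F (mi n i) (zi n hn) = G (mi n i) (zi n hn))
    (h5 : ∀ i j, F (mi n i) (mi n j) = G (mi n i) (mi n j))
    (h6 : ∀ i, F (mi n i) (li n hn) = G (mi n i) (li n hn))
    (h7 : F (li n hn) (zi n hn) = G (li n hn) (zi n hn))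
    (h8 : ∀ j, F (li n hn) (mi n j) = G (li n hn) (mi n j))
    (h9 : F (li n hn) (li n hn) = G (li n hn) (li n hn)) : F = G := by
  ext i j
  rcases idx_cases n hn i with rfl | ⟨i, rfl⟩ | rfl <;>
  rcases idx_cases n hn j with rfl | ⟨j, rfl⟩ | rfl <;> simp [*]

lemma vec_ext {F G : Fin (2 * n) → ℝ}
    (h1 : F (zi n hn) = G (zi n hn)) (h2 : ∀ j, F (mi n j) = G (mi n j))
    (h3 : F (li n hn) = G (li n hn)) : F = G := by
  ext i
  rcases idx_cases n hn i with rfl | ⟨i, rfl⟩ | rfl <;> simp [*]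

include hn in
lemma blk_mul (M M' : Matrix (Fin (2 * (n - 1))) (Fin (2 * (n - 1))) ℝ)
    (u v u' v' : Fin (2 * (n - 1)) → ℝ) (a lam a' lam' : ℝ) :
    blockF n M u v a lam * blockF n M' u' v' a' lam' =
    blockF n (M * M') (u + M *ᵥ u') (v ᵥ* M' + lam • v') (a + v ⬝ᵥ u' + lam * a')
      (lam * lam') := by
  apply blk_ext n hn <;> intros <;>
  simp [Matrix.mul_apply, sum_split n hn, blk_zz, blk_zm, blk_zl, blk_mz, blk_mm, blk_ml,
    blk_lz, blk_lm, blk_ll, mulVec, vecMul, dotProduct]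

include hn in
lemma blk_one : blockF n 1 0 0 0 1 = 1 := by
  apply blk_ext n hn <;> intros <;>
  simp [blk_zz, blk_zm, blk_zl, blk_mz, blk_mm, blk_ml,
    blk_lz, blk_lm, blk_ll, Matrix.one_apply, mi_inj, zi_ne_mi, mi_ne_zi, zi_ne_li, li_ne_zi,
    mi_ne_li, li_ne_mi]

section blkv
variable (M : Matrix (Fin (2 * (n - 1))) (Fin (2 * (n - 1))) ℝ)
    (u v : Fin (2 * (n - 1)) → ℝ) (a lam : ℝ) (x : Fin (2 * n) → ℝ)
lemma blkv_z : (blockF n M u v a lam *ᵥ x) (zi n hn) = x (zi n hn) := by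
  simp [mulVec, dotProduct, sum_split n hn, blk_zz, blk_zm, blk_zl]
include hn in
lemma blkv_m : (fun i => (blockF n M u v a lam *ᵥ x) (mi n i)) =
    x (zi n hn) • u + M *ᵥ (fun i => x (mi n i)) := by
  ext i
  simp [mulVec, dotProduct, sum_split n hn, blk_mz, blk_mm, blk_ml]
  ring
lemma blkv_l : (blockF n M u v a lam *ᵥ x) (li n hn) =
    a * x (zi n hn) + v ⬝ᵥ (fun i => x (mi n i)) + lam * x (li n hn) := by
  simp [mulVec, dotProduct, sum_split n hn, blk_lz, blk_lm, blk_ll]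
end blkv

lemma J_T (m : ℕ) : (Jmat m)ᵀ = - Jmat m := by
  ext i j
  have := i.2
  have := j.2
  simp only [Jmat, transpose_apply, Matrix.neg_apply]
  split_ifs <;> first | omega | (norm_num; done) | grind

lemma J_sq (m : ℕ) : Jmat m * Jmat m = - 1 := by
  ext i j
  have := i.2
  have := j.2
  rw [Matrix.mul_apply]
  by_cases h : i.val < m
  · rw [Finset.sum_eq_single ⟨i.val + m, by omega⟩]
    · simp only [Jmat, Matrix.neg_apply, Matrix.one_apply, Fin.ext_iff]
      split_ifs <;> first | omega | (norm_num; done) | grind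
    · intro k _ hk
      have := k.2
      have : k.val ≠ i.val + m := fun h => hk (Fin.ext h)
      simp only [Jmat]
      split_ifs <;> first | omega | (norm_num; done) | grind
    · simp
  · rw [Finset.sum_eq_single ⟨i.val - m, by omega⟩]
    · simp only [Jmat, Matrix.neg_apply, Matrix.one_apply, Fin.ext_iff]
      split_ifs <;> first | omega | (norm_num; done) | grind
    · intro k _ hk
      have := k.2
      have : k.val ≠ i.val - m := fun h => hk (Fin.ext h)
      simp only [Jmat]
      split_ifs <;> first | omega | (norm_num; done) | grind
    · simp

lemma J_swap (m : ℕ) (p q : Fin (2 * m) → ℝ) : p ⬝ᵥ Jmat m *ᵥ q = - (q ⬝ᵥ Jmat m *ᵥ p) := by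
  rw [dotProduct_comm, ← vecMul_transpose, J_T, ← dotProduct_mulVec]
  simp [neg_mulVec]

include hn in
/-- Sufficient conditions for a block matrix to preserve the bracket. -/
lemma blk_bracket (M : Matrix (Fin (2 * (n - 1))) (Fin (2 * (n - 1))) ℝ)
    (u v : Fin (2 * (n - 1)) → ℝ) (a lam : ℝ)
    (hM : Mᵀ * Jmat (n - 1) * M = lam • Jmat (n - 1))
    (huv : ∀ y, v ⬝ᵥ y = 2 * (u ⬝ᵥ Jmat (n - 1) *ᵥ (M *ᵥ y))) (x y : Fin (2 * n) → ℝ) :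
    blockF n M u v a lam *ᵥ bracket n x y =
      bracket n (blockF n M u v a lam *ᵥ x) (blockF n M u v a lam *ᵥ y) := by
  have hm := fun x : Fin (2 * n) → ℝ => fun i => congrFun (blkv_m n hn M u v a lam x) i
  have hb : (fun i => bracket n x y (mi n i)) = (1 / 2 : ℝ) • (x (zi n hn) • (fun i => y (mi n i)) -
      y (zi n hn) • (fun i => x (mi n i))) := by
    ext i; simp [bracket_m n hn]
  have hJ : ∀ p q, (M *ᵥ p) ⬝ᵥ Jmat (n - 1) *ᵥ (M *ᵥ q) = lam * (p ⬝ᵥ Jmat (n - 1) *ᵥ q) := by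
    intro p q
    have := congrArg (fun N => p ⬝ᵥ N *ᵥ q) hM
    simp only [smul_mulVec, dotProduct_smul, smul_eq_mul] at this
    rw [← this, ← mulVec_mulVec, ← mulVec_mulVec, dotProduct_mulVec p, vecMul_transpose]
  apply vec_ext n hn
  · rw [blkv_z, bracket_z, bracket_z]
  · intro i
    rw [hm, bracket_m n hn, hm, hm, blkv_z, blkv_z, bracket_z, hb]
    simp [mulVec_smul, mulVec_sub]
    ring
  · rw [blkv_l, bracket_l, bracket_l, blkv_m n hn, blkv_m n hn, hb, blkv_z, blkv_z, blkv_l, blkv_l,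
      bracket_z]
    simp only [mulVec_add, mulVec_smul, dotProduct_add, dotProduct_smul, add_dotProduct,
      smul_dotProduct, dotProduct_sub, mulVec_sub, hJ, huv, smul_eq_mul]
    rw [J_swap _ (M *ᵥ _) u]
    have : u ⬝ᵥ Jmat (n - 1) *ᵥ u = 0 := by have := J_swap _ u u; linarith
    rw [this]
    ring

lemma IsAut.mul {F G : Matrix (Fin (2 * n)) (Fin (2 * n)) ℝ} (hF : IsAut n F) (hG : IsAut n G) :
    IsAut n (F * G) :=
  ⟨hF.1.mul hG.1, fun u v => by
    rw [← mulVec_mulVec, hG.2, hF.2, mulVec_mulVec, mulVec_mulVec]⟩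

include hn in
lemma aut_Fd (α : ℝ) (h : 0 < α) : IsAut n (Fd n α) := by
  refine ⟨ru n (B := Fd n α⁻¹) ?_, fun x y => ?_⟩
  · rw [Fd, Fd, blk_mul n hn, ← blk_one n hn]
    congr 1 <;> simp [h.ne', smul_smul]
  · apply blk_bracket n hn
    · simp [smul_smul, sq]
    · simp

include hn in
lemma aut_FSp (M : Matrix (Fin (2 * (n - 1))) (Fin (2 * (n - 1))) ℝ)
    (h : Mᵀ * Jmat (n - 1) * M = Jmat (n - 1)) : IsAut n (FSp n M) := by
  have h1 : (- (Jmat (n - 1) * Mᵀ * Jmat (n - 1))) * M = 1 := by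
    rw [Matrix.neg_mul, Matrix.mul_assoc, Matrix.mul_assoc, ← Matrix.mul_assoc Mᵀ, h, J_sq]
    simp
  refine ⟨ru n
    (B := FSp n (- (Jmat (n - 1) * Mᵀ * Jmat (n - 1)))) ?_, fun x y => ?_⟩
  · rw [FSp, FSp, blk_mul n hn, ← blk_one n hn]
    congr 1
    · exact mul_eq_one_comm.mp h1
    all_goals simp
  · apply blk_bracket n hn
    · simp [h]
    · simp

include hn in
lemma aut_Ft (v : Fin (2 * (n - 1)) → ℝ) (a : ℝ) : IsAut n (Ft n v a) := by
  refine ⟨ru n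
    (B := Ft n (-v) (-a - v ⬝ᵥ ((2 : ℝ)⁻¹ • (Jmat (n - 1)).mulVec (-v)))) ?_, fun x y => ?_⟩
  · rw [Ft, Ft, blk_mul n hn, ← blk_one n hn]
    congr 1 <;> simp [mulVec_neg]
    ring
  · apply blk_bracket n hn
    · simp
    · intro y
      rw [one_mulVec, smul_dotProduct, dotProduct_mulVec, ← mulVec_transpose, mulVec_mulVec,
        J_T, Matrix.neg_mul, J_sq]
      simp

include hn in
lemma prod_eq (α : ℝ) (M : Matrix (Fin (2 * (n - 1))) (Fin (2 * (n - 1))) ℝ)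
    (v : Fin (2 * (n - 1)) → ℝ) (a : ℝ) : Fd n α * FSp n M * Ft n v a =
    blockF n (α • M) (α • (M *ᵥ ((2 : ℝ)⁻¹ • (Jmat (n - 1) *ᵥ v)))) (α ^ 2 • v) (α ^ 2 * a)
      (α ^ 2) := by
  rw [Fd, FSp, Ft, blk_mul n hn, blk_mul n hn]
  congr 1 <;> simp [smul_mulVec]

include hn in
lemma blk_inj {M M' : Matrix (Fin (2 * (n - 1))) (Fin (2 * (n - 1))) ℝ}
    {u v u' v' : Fin (2 * (n - 1)) → ℝ} {a lam a' lam' : ℝ}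
    (h : blockF n M u v a lam = blockF n M' u' v' a' lam') :
    M = M' ∧ u = u' ∧ v = v' ∧ a = a' ∧ lam = lam' := by
  refine ⟨?_, ?_, ?_, ?_, ?_⟩
  · ext i j
    rw [← blk_mm n M u v a lam, h, blk_mm]
  · ext i
    rw [← blk_mz n hn M u v a lam, h, blk_mz]
  · ext i
    rw [← blk_lm n hn M u v a lam, h, blk_lm]
  · rw [← blk_lz n hn M u v a lam, h, blk_lz]
  · rw [← blk_ll n hn M u v a lam, h, blk_ll]

include hn in
lemma aut_form (F : Matrix (Fin (2 * n)) (Fin (2 * n)) ℝ) (hF : IsAut n F) :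
    ∃ (M : Matrix (Fin (2 * (n - 1))) (Fin (2 * (n - 1))) ℝ)
      (u v : Fin (2 * (n - 1)) → ℝ) (a lam : ℝ), F = blockF n M u v a lam ∧ lam ≠ 0 ∧
      Mᵀ * Jmat (n - 1) * M = lam • Jmat (n - 1) ∧
      v = (-2 : ℝ) • (Mᵀ *ᵥ (Jmat (n - 1) *ᵥ u)) := by
  obtain ⟨hU, hB⟩ := hF
  -- brackets of basis vectors
  let E : Fin (2 * n) → Fin (2 * n) → ℝ := fun i => Pi.single i 1
  have hE : ∀ i j, (F *ᵥ E i) j = F j i := by intro i j; simp [E]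
  have emz : ∀ i, (fun k => E (zi n hn) (mi n k)) = 0 ∧ (fun k => E (li n hn) (mi n k)) = 0 ∧
      (fun k => E (mi n i) (mi n k)) = Pi.single i 1 := by
    intro i
    refine ⟨?_, ?_, ?_⟩
    · ext k; simp [E, Pi.single_apply, mi_ne_zi]
    · ext k; simp [E, Pi.single_apply, mi_ne_li]
    · ext k; simp [E, Pi.single_apply, mi_inj]
  have bzl : bracket n (E (zi n hn)) (E (li n hn)) = E (li n hn) := by
    apply vec_ext n hn
    · rw [bracket_z]; simp [E, zi_ne_li]
    · intro k; rw [bracket_m n hn]; simp [E, Pi.single_apply, mi_ne_li, mi_ne_zi]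
    · rw [bracket_l, (emz ⟨0, by omega⟩).1]; simp [E, zi_ne_li]
  have bzm : ∀ i, bracket n (E (zi n hn)) (E (mi n i)) = (1 / 2 : ℝ) • E (mi n i) := by
    intro i
    apply vec_ext n hn
    · rw [bracket_z]; simp [E, zi_ne_mi]
    · intro k; rw [bracket_m n hn]; simp [E, Pi.single_apply, zi_ne_mi, mi_inj]
    · rw [bracket_l, (emz ⟨0, by omega⟩).1]; simp [E, zi_ne_mi, li_ne_mi, li_ne_zi]
  have bmm : ∀ i j, bracket n (E (mi n i)) (E (mi n j)) =
      (- Jmat (n - 1) i j) • E (li n hn) := by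
    intro i j
    apply vec_ext n hn
    · rw [bracket_z]; simp [E, zi_ne_li]
    · intro k; rw [bracket_m n hn]; simp [E, zi_ne_mi, mi_ne_li]
    · rw [bracket_l, (emz i).2.2, (emz j).2.2]; simp [E, zi_ne_mi]
  -- first row
  have r1 : ∀ j, F (zi n hn) (mi n j) = 0 := by
    intro j
    have := congrFun (hB (E (zi n hn)) (E (mi n j))) (zi n hn)
    rw [bracket_z, bzm, mulVec_smul, Pi.smul_apply, hE] at this
    simpa using this
  have r2 : F (zi n hn) (li n hn) = 0 := by
    have := congrFun (hB (E (zi n hn)) (E (li n hn))) (zi n hn)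
    rw [bracket_z, bzl, hE] at this
    exact this
  -- last column
  have c1 : ∀ k, F (mi n k) (li n hn) = 0 := by
    intro k
    have := congrFun (hB (E (mi n ⟨0, by omega⟩)) (E (mi n ⟨n - 1, by omega⟩))) (mi n k)
    rw [bracket_m n hn, bmm, mulVec_smul, Pi.smul_apply] at this
    simp only [hE, r1] at this
    simpa [Jmat] using this
  have hl : F (li n hn) (li n hn) ≠ 0 := by
    intro h0
    have hz : F *ᵥ E (li n hn) = 0 := by
      apply vec_ext n hn
      · rw [hE, r2]; rfl
      · intro k; rw [hE, c1]; rfl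
      · rw [hE, h0]; rfl
    have := (Matrix.mulVec_injective_iff_isUnit.mpr hU) (hz.trans (mulVec_zero F).symm)
    have := congrFun this (li n hn)
    simp [E] at this
  have c0 : F (zi n hn) (zi n hn) = 1 := by
    have := congrFun (hB (E (zi n hn)) (E (li n hn))) (li n hn)
    rw [bracket_l, bzl] at this
    simp only [hE, r2, c1] at this
    have h0 : (fun i : Fin (2 * (n - 1)) => (0 : ℝ)) = 0 := rfl
    rw [h0] at this
    simp only [mulVec_zero, dotProduct_zero, zero_mul, sub_zero] at this
    exact mul_right_cancel₀ hl (by linarith)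
  have hm : ∀ i j, (F.submatrix (mi n) (mi n))ᵀ i ⬝ᵥ Jmat (n - 1) *ᵥ
      (F.submatrix (mi n) (mi n))ᵀ j = F (li n hn) (li n hn) * Jmat (n - 1) i j := by
    intro i j
    have := congrFun (hB (E (mi n i)) (E (mi n j))) (li n hn)
    rw [bracket_l, bmm, mulVec_smul, Pi.smul_apply] at this
    simp only [hE, r1, smul_eq_mul] at this
    have e : ∀ i, (F.submatrix (mi n) (mi n))ᵀ i = fun k => F (mi n k) (mi n i) := fun _ => rfl
    rw [e, e]
    linarith
  have hv : ∀ j, F (li n hn) (mi n j) = (-2) * ((F.submatrix (mi n) (mi n))ᵀ j ⬝ᵥ Jmat (n - 1) *ᵥ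
      (fun i => F (mi n i) (zi n hn))) := by
    intro j
    have := congrFun (hB (E (zi n hn)) (E (mi n j))) (li n hn)
    rw [bracket_l, bzm, mulVec_smul, Pi.smul_apply] at this
    simp only [hE, r1, smul_eq_mul, c0] at this
    have e : ∀ i, (F.submatrix (mi n) (mi n))ᵀ i = fun k => F (mi n k) (mi n i) := fun _ => rfl
    rw [e, J_swap]
    linarith
  refine ⟨F.submatrix (mi n) (mi n), fun i => F (mi n i) (zi n hn), fun j => F (li n hn) (mi n j),
    F (li n hn) (zi n hn), F (li n hn) (li n hn), ?_, hl, ?_, ?_⟩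
  · apply blk_ext n hn <;> intros <;>
    simp [blk_zz, blk_zm, blk_zl, blk_mz, blk_mm, blk_ml,
      blk_lz, blk_lm, blk_ll, r1, r2, c1, c0]
  · ext i j
    rw [Matrix.smul_apply, smul_eq_mul, ← hm, Matrix.mul_assoc]
    simp only [Matrix.mul_apply, mulVec, dotProduct, transpose_apply]
  · ext j
    rw [hv]
    rfl

include hn in
lemma factor (F : Matrix (Fin (2 * n)) (Fin (2 * n)) ℝ) (hF : IsAut n F)
    (h0 : 0 < F (li n hn) (li n hn)) :
    ∃ (α : ℝ) (M : Matrix (Fin (2 * (n - 1))) (Fin (2 * (n - 1))) ℝ)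
          (v : Fin (2 * (n - 1)) → ℝ) (a : ℝ),
          0 < α ∧ M.transpose * Jmat (n - 1) * M = Jmat (n - 1) ∧
          F = Fd n α * FSp n M * Ft n v a := by
  obtain ⟨M, u, v, a, lam, rfl, hl, hM, hv⟩ := aut_form n hn F hF
  rw [blk_ll] at h0
  have hα : 0 < √lam := Real.sqrt_pos.mpr h0
  have hsq : √lam ^ 2 = lam := Real.sq_sqrt h0.le
  have hMM : (√lam)⁻¹ * (√lam)⁻¹ * lam = 1 := by
    field_simp
    exact hsq.symm
  refine ⟨√lam, (√lam)⁻¹ • M, lam⁻¹ • v, lam⁻¹ * a, hα, ?_, ?_⟩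
  · simp only [transpose_smul, Matrix.smul_mul, Matrix.mul_smul, smul_smul, hM, ← mul_assoc, hMM, one_smul]
  · rw [prod_eq n hn, hsq]
    have h1 : (- (lam⁻¹ • (Jmat (n - 1) * Mᵀ * Jmat (n - 1)))) * M = 1 := by
      rw [Matrix.neg_mul, Matrix.smul_mul, Matrix.mul_assoc, Matrix.mul_assoc,
        ← Matrix.mul_assoc Mᵀ, hM, Matrix.mul_smul, J_sq, smul_smul, inv_mul_cancel₀ hl]
      simp
    have h2 := mul_eq_one_comm.mp h1
    congr 1
    · rw [smul_smul, mul_inv_cancel₀ hα.ne', one_smul]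
    · rw [smul_mulVec, smul_smul, mul_inv_cancel₀ hα.ne', one_smul, hv]
      have := congrArg (fun N => N *ᵥ u) h2
      simp only [one_mulVec] at this
      conv_lhs => rw [← this]
      simp only [mulVec_smul, mulVec_mulVec, Matrix.mul_neg, Matrix.mul_smul, neg_mulVec,
        smul_mulVec, smul_smul, Matrix.mul_assoc]
      rw [← neg_smul]
      congr 1
      ring
    · rw [smul_smul, mul_inv_cancel₀ hl, one_smul]
    · rw [← mul_assoc, mul_inv_cancel₀ hl, one_mul]

include hn in
lemma unique_factor (α α' : ℝ) (M M' : Matrix (Fin (2 * (n - 1))) (Fin (2 * (n - 1))) ℝ)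
    (v v' : Fin (2 * (n - 1)) → ℝ) (a a' : ℝ) (h : 0 < α) (h' : 0 < α')
    (e : Fd n α * FSp n M * Ft n v a = Fd n α' * FSp n M' * Ft n v' a') :
      α = α' ∧ M = M' ∧ v = v' ∧ a = a' := by
  rw [prod_eq n hn, prod_eq n hn] at e
  obtain ⟨e1, -, e3, e4, e5⟩ := blk_inj n hn e
  obtain rfl : α = α' := by
    nlinarith [sq_nonneg (α - α'), mul_pos h h', (pow_left_inj₀ h.le h'.le two_ne_zero).mp e5]
  have h2 : α ^ 2 ≠ 0 := by positivity
  exact ⟨rfl, smul_right_injective _ h.ne' e1, smul_right_injective _ h2 e3,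
    mul_left_cancel₀ h2 e4⟩

include hn in
lemma cont_blk {M : ℝ → Matrix (Fin (2 * (n - 1))) (Fin (2 * (n - 1))) ℝ}
    {u v : ℝ → Fin (2 * (n - 1)) → ℝ} {a lam : ℝ → ℝ} (h1 : Continuous M) (h2 : Continuous u)
    (h3 : Continuous v) (h4 : Continuous a) (h5 : Continuous lam) :
    Continuous fun t => blockF n (M t) (u t) (v t) (a t) (lam t) := by
  refine continuous_matrix fun i j => ?_
  rcases idx_cases n hn i with rfl | ⟨i, rfl⟩ | rfl <;>
  rcases idx_cases n hn j with rfl | ⟨j, rfl⟩ | rfl <;>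
  simp only [blk_zz, blk_zm, blk_zl, blk_mz, blk_mm, blk_ml, blk_lz, blk_lm, blk_ll] <;>
  fun_prop

include hn in
lemma path (F : Matrix (Fin (2 * n)) (Fin (2 * n)) ℝ) (hF : IsAut n F)
    (h0 : 0 < F (li n hn) (li n hn)) :
    ∃ γ : ℝ → Matrix (Fin (2 * n)) (Fin (2 * n)) ℝ, Continuous γ ∧ (∀ t, IsAut n (γ t)) ∧
      γ 0 = 1 ∧ γ 1 = F := by
  obtain ⟨α, M, v, a, hα, hM, rfl⟩ := factor n hn F hF h0
  obtain ⟨γ, c, hγ, g0, g1⟩ := Jmat_path (n - 1) M hM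
  refine ⟨fun t => Fd n (Real.exp (t * Real.log α)) * FSp n (γ t) * Ft n (t • v) (t * a), ?_,
    fun t => ?_, ?_, ?_⟩
  · simp only [prod_eq n hn]
    apply cont_blk n hn
    · fun_prop
    · have q : Continuous fun t : ℝ => Real.exp (t * Real.log α) := by fun_prop
      have q2 : Continuous fun t : ℝ => t • v := by fun_prop
      have q0 : Continuous fun t : ℝ => Jmat (n - 1) *ᵥ (t • v) :=
        continuous_const.matrix_mulVec q2
      have q3 : Continuous fun t : ℝ => (2 : ℝ)⁻¹ • (Jmat (n - 1) *ᵥ (t • v)) := by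
        exact q0.const_smul (2 : ℝ)⁻¹
      exact q.smul (c.matrix_mulVec q3)
    all_goals fun_prop
  · exact ((aut_Fd n hn _ (Real.exp_pos _)).mul n (aut_FSp n hn _ (hγ t))).mul n (aut_Ft n hn _ _)
  · simp only [prod_eq n hn]
    rw [← blk_one n hn]
    congr 1 <;> simp [g0]
  · simp [g1, Real.exp_log hα]

end Aut

/-- An automorphism of `𝔠𝔥(n)` has positive lower-right entry `λ` iff it factors
(uniquely) as `F_d(α)·F_Sp(M)·F_t(v,a)`; the set of such automorphisms is exactly
the identity component of the automorphism group. -/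
theorem identity_component (n : ℕ) (hn : 2 ≤ n) :
    (∀ F, IsAut n F →
      (0 < F ⟨2 * n - 1, by omega⟩ ⟨2 * n - 1, by omega⟩ ↔
        ∃ (α : ℝ) (M : Matrix (Fin (2 * (n - 1))) (Fin (2 * (n - 1))) ℝ)
          (v : Fin (2 * (n - 1)) → ℝ) (a : ℝ),
          0 < α ∧ M.transpose * Jmat (n - 1) * M = Jmat (n - 1) ∧
          F = Fd n α * FSp n M * Ft n v a)) ∧
    (∀ (α α' : ℝ) (M M' : Matrix (Fin (2 * (n - 1))) (Fin (2 * (n - 1))) ℝ)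
        (v v' : Fin (2 * (n - 1)) → ℝ) (a a' : ℝ),
      0 < α → 0 < α' →
      M.transpose * Jmat (n - 1) * M = Jmat (n - 1) →
      M'.transpose * Jmat (n - 1) * M' = Jmat (n - 1) →
      Fd n α * FSp n M * Ft n v a = Fd n α' * FSp n M' * Ft n v' a' →
      α = α' ∧ M = M' ∧ v = v' ∧ a = a') ∧
    {F : Matrix (Fin (2 * n)) (Fin (2 * n)) ℝ |
        IsAut n F ∧ 0 < F ⟨2 * n - 1, by omega⟩ ⟨2 * n - 1, by omega⟩}
      = connectedComponentIn {F | IsAut n F} 1 := by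
  refine ⟨fun F hF => ⟨fun h => factor n hn F hF h, ?_⟩, ?_, ?_⟩
  · rintro ⟨α, M, v, a, hα, hM, rfl⟩
    rw [prod_eq n hn]
    have := blk_ll n hn (α • M) (α • (M *ᵥ ((2 : ℝ)⁻¹ • (Jmat (n - 1) *ᵥ v)))) (α ^ 2 • v)
      (α ^ 2 * a) (α ^ 2)
    rw [li] at this
    rw [this]
    positivity
  · intro α α' M M' v v' a a' h h' _ _ e
    exact unique_factor n hn α α' M M' v v' a a' h h' e
  · have h1 : IsAut n 1 := ⟨isUnit_one, by simp⟩
    ext F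
    constructor
    · rintro ⟨hF, h0⟩
      obtain ⟨γ, c, hγ, g0, g1⟩ := path n hn F hF h0
      have hp : IsPreconnected (Set.range γ) := isPreconnected_range c
      refine hp.subset_connectedComponentIn ⟨0, g0⟩ ?_ ⟨1, g1⟩
      rintro _ ⟨t, rfl⟩
      exact hγ t
    · intro hF
      have hA : IsAut n F := connectedComponentIn_subset {F | IsAut n F} 1 hF
      refine ⟨hA, ?_⟩
      by_contra hneg
      have hp := (isPreconnected_connectedComponentIn (F := {F | IsAut n F}) (x := 1)).image
        (fun G => G (li n hn) (li n hn)) (by fun_prop)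
      have hm1 : (1 : Matrix (Fin (2 * n)) (Fin (2 * n)) ℝ) ∈
        connectedComponentIn {F | IsAut n F} 1 := mem_connectedComponentIn h1
      obtain ⟨G, hG, hG0⟩ := hp.ordConnected.out (Set.mem_image_of_mem _ hF)
        (Set.mem_image_of_mem _ hm1) (show (0 : ℝ) ∈ _ from ⟨not_lt.mp hneg, by simp⟩)
      obtain ⟨M, u, v, a, lam, rfl, hl, -, -⟩ := aut_form n hn G
        (connectedComponentIn_subset {F | IsAut n F} 1 hG)
      exact hl (by simpa [blk_ll] using hG0)

end CHn
end
end

section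
/- Let (p, x, σ, β) be admissible parameters with z = p − Σ_{i=1}^{n−1} x_i²/σ_i > 0, and let v = σ^{−1}x ∈ ℝ^{n−1}. The matrix of the Ricci form of the inner product S(p, x, σ, β) on 𝔠𝔥(n), in the ordered basis, is Ric = −(1/(2z))·[[np+z, nxᵀ, 0, 0],[nx, nσ+βzσ^{−1}, 0, 0],[0, 0, nσ+βzσ^{−1}+βvvᵀ, (2n+1)(β/2)v],[0, 0, (2n+1)(β/2)vᵀ, 2nβ−β²Σ_{k=1}^{n−1}(1/σ_k²)(x_k²/σ_k+z)]] (blocks of sizes 1, n−1, n−1, 1). -/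
noncomputable section

open Matrix BigOperators Finset

namespace CHn

/-- The claimed matrix of the Ricci form of `g(p,x,σ,β)`:
`Ric = -(1/(2z)) [[np+z, nxᵀ, 0, 0], [nx, nσ+βzσ⁻¹, 0, 0],
[0, 0, nσ+βzσ⁻¹+βvvᵀ, (2n+1)(β/2)v], [0, 0, (2n+1)(β/2)vᵀ, 2nβ-β²Σ_k σ_k⁻²(x_k²/σ_k+z)]]`,
where `v = σ⁻¹x`. -/
def ricMat (n : ℕ) (p β : ℝ) (x σ : Fin (n - 1) → ℝ) :
    Matrix (Fin (2 * n)) (Fin (2 * n)) ℝ := fun i j =>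
  -(1 / (2 * zval n p x σ)) *
    (if i.val = 0 ∧ j.val = 0 then (n : ℝ) * p + zval n p x σ
     else if h : i.val = 0 ∧ 1 ≤ j.val ∧ j.val ≤ n - 1 then
       (n : ℝ) * x ⟨j.val - 1, by omega⟩
     else if h : j.val = 0 ∧ 1 ≤ i.val ∧ i.val ≤ n - 1 then
       (n : ℝ) * x ⟨i.val - 1, by omega⟩
     else if h : i = j ∧ 1 ≤ i.val ∧ i.val ≤ n - 1 then
       (n : ℝ) * σ ⟨i.val - 1, by omega⟩ + β * zval n p x σ / σ ⟨i.val - 1, by omega⟩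
     else if h : n ≤ i.val ∧ i.val ≤ 2 * n - 2 ∧ n ≤ j.val ∧ j.val ≤ 2 * n - 2 then
       (if i = j then
          (n : ℝ) * σ ⟨i.val - n, by omega⟩ + β * zval n p x σ / σ ⟨i.val - n, by omega⟩
        else 0)
       + β * (x ⟨i.val - n, by omega⟩ / σ ⟨i.val - n, by omega⟩)
           * (x ⟨j.val - n, by omega⟩ / σ ⟨j.val - n, by omega⟩)
     else if h : n ≤ i.val ∧ i.val ≤ 2 * n - 2 ∧ j.val = 2 * n - 1 then
       (2 * (n : ℝ) + 1) * (β / 2) * (x ⟨i.val - n, by omega⟩ / σ ⟨i.val - n, by omega⟩)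
     else if h : n ≤ j.val ∧ j.val ≤ 2 * n - 2 ∧ i.val = 2 * n - 1 then
       (2 * (n : ℝ) + 1) * (β / 2) * (x ⟨j.val - n, by omega⟩ / σ ⟨j.val - n, by omega⟩)
     else if i.val = 2 * n - 1 ∧ j.val = 2 * n - 1 then
       2 * (n : ℝ) * β - β ^ 2 * ∑ k, (1 / (σ k) ^ 2) * ((x k) ^ 2 / σ k + zval n p x σ)
     else 0)



def iX (m : ℕ) : Fin (2 * (m + 1)) := ⟨0, by omega⟩
def iY (m : ℕ) (i : Fin m) : Fin (2 * (m + 1)) := ⟨i.val + 1, by omega⟩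
def iZ (m : ℕ) (i : Fin m) : Fin (2 * (m + 1)) := ⟨i.val + (m + 1), by omega⟩
def iW (m : ℕ) : Fin (2 * (m + 1)) := ⟨2 * m + 1, by omega⟩

lemma idx_cases_s7 {m : ℕ} {P : Fin (2 * (m + 1)) → Prop} (hX : P (iX m)) (hY : ∀ i, P (iY m i))
    (hZ : ∀ i, P (iZ m i)) (hW : P (iW m)) (t : Fin (2 * (m + 1))) : P t := by
  obtain ⟨t, ht⟩ := t
  by_cases h0 : t = 0
  · subst h0; exact hX
  by_cases h1 : t ≤ m
  · have := hY ⟨t - 1, by omega⟩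
    have e : iY m ⟨t - 1, by omega⟩ = ⟨t, ht⟩ := by simp [iY]; omega
    rwa [e] at this
  by_cases h2 : t ≤ 2 * m
  · have := hZ ⟨t - (m + 1), by omega⟩
    have e : iZ m ⟨t - (m + 1), by omega⟩ = ⟨t, ht⟩ := by simp [iZ]; omega
    rwa [e] at this
  have e : iW m = ⟨t, ht⟩ := by simp [iW]; omega
  rwa [e] at hW

lemma idx_sum {m : ℕ} (f : Fin (2 * (m + 1)) → ℝ) :
    ∑ t, f t = f (iX m) + ∑ i, f (iY m i) + ∑ i, f (iZ m i) + f (iW m) := by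
  rw [← (finCongr (show 1 + m + m + 1 = 2 * (m + 1) by omega)).sum_comp]
  rw [Fin.sum_univ_add, Fin.sum_univ_add, Fin.sum_univ_add]
  simp only [Fin.sum_univ_one]
  congr 1
  · congr 1
    · congr 1
      refine Finset.sum_congr rfl fun i _ => ?_
      congr 1; ext; simp [iY]; try omega
    · refine Finset.sum_congr rfl fun i _ => ?_
      congr 1; ext; simp [iZ]; try omega
  · congr 1; ext; simp [iW]; try omega

@[simp] lemma iX_ne_iY {m : ℕ} (i : Fin m) : iX m ≠ iY m i := by simp [iX, iY]
@[simp] lemma iX_ne_iZ {m : ℕ} (i : Fin m) : iX m ≠ iZ m i := by simp [iX, iZ]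
@[simp] lemma iX_ne_iW {m : ℕ} : iX m ≠ iW m := by simp [iX, iW]
@[simp] lemma iY_ne_iX {m : ℕ} (i : Fin m) : iY m i ≠ iX m := (iX_ne_iY i).symm
@[simp] lemma iZ_ne_iX {m : ℕ} (i : Fin m) : iZ m i ≠ iX m := (iX_ne_iZ i).symm
@[simp] lemma iW_ne_iX {m : ℕ} : iW m ≠ iX m := iX_ne_iW.symm
@[simp] lemma iY_ne_iZ {m : ℕ} (i j : Fin m) : iY m i ≠ iZ m j := by simp [iY, iZ]; omega
@[simp] lemma iZ_ne_iY {m : ℕ} (i j : Fin m) : iZ m i ≠ iY m j := (iY_ne_iZ j i).symm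
@[simp] lemma iY_ne_iW {m : ℕ} (i : Fin m) : iY m i ≠ iW m := by simp [iY, iW]; omega
@[simp] lemma iW_ne_iY {m : ℕ} (i : Fin m) : iW m ≠ iY m i := (iY_ne_iW i).symm
@[simp] lemma iZ_ne_iW {m : ℕ} (i : Fin m) : iZ m i ≠ iW m := by simp [iZ, iW]; omega
@[simp] lemma iW_ne_iZ {m : ℕ} (i : Fin m) : iW m ≠ iZ m i := (iZ_ne_iW i).symm
@[simp] lemma iY_inj {m : ℕ} (i j : Fin m) : iY m i = iY m j ↔ i = j := by
  simp [iY, Fin.ext_iff]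
@[simp] lemma iZ_inj {m : ℕ} (i j : Fin m) : iZ m i = iZ m j ↔ i = j := by
  simp [iZ, Fin.ext_iff]

section structure_constants
variable {m : ℕ} (i j : Fin m) (k : Fin (2 * (m + 1)))

lemma sc_anti (a b k : Fin (2 * (m + 1))) :
    structC (m + 1) a b k = - structC (m + 1) b a k := by
  unfold structC; ring

lemma sc_XX : structC (m + 1) (iX m) (iX m) k = 0 := by simp [structC, iX]
lemma sc_XY : structC (m + 1) (iX m) (iY m i) k = if k = iY m i then 1 / 2 else 0 := by
  simp only [structC, iX, iY, Fin.ext_iff]; grind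
lemma sc_XZ : structC (m + 1) (iX m) (iZ m i) k = if k = iZ m i then 1 / 2 else 0 := by
  simp only [structC, iX, iZ, Fin.ext_iff]; grind
lemma sc_XW : structC (m + 1) (iX m) (iW m) k = if k = iW m then 1 else 0 := by
  simp only [structC, iX, iW, Fin.ext_iff]; grind
lemma sc_YY : structC (m + 1) (iY m i) (iY m j) k = 0 := by
  simp only [structC, iY, Fin.ext_iff]; grind
lemma sc_ZY : structC (m + 1) (iZ m i) (iY m j) k =
    if i = j then (if k = iW m then 1 else 0) else 0 := by
  simp only [structC, iY, iZ, iW, Fin.ext_iff]; grind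
lemma sc_ZZ : structC (m + 1) (iZ m i) (iZ m j) k = 0 := by
  simp only [structC, iZ, Fin.ext_iff]; grind
lemma sc_YW : structC (m + 1) (iY m i) (iW m) k = 0 := by
  simp only [structC, iY, iW, Fin.ext_iff]; grind
lemma sc_ZW : structC (m + 1) (iZ m i) (iW m) k = 0 := by
  simp only [structC, iZ, iW, Fin.ext_iff]; grind
lemma sc_WW : structC (m + 1) (iW m) (iW m) k = 0 := by
  simp only [structC, iW, Fin.ext_iff]; grind
lemma sc_YX : structC (m + 1) (iY m i) (iX m) k = -(if k = iY m i then 1 / 2 else 0) := by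
  rw [sc_anti, sc_XY]
lemma sc_ZX : structC (m + 1) (iZ m i) (iX m) k = -(if k = iZ m i then 1 / 2 else 0) := by
  rw [sc_anti, sc_XZ]
lemma sc_WX : structC (m + 1) (iW m) (iX m) k = -(if k = iW m then 1 else 0) := by
  rw [sc_anti, sc_XW]
lemma sc_YZ : structC (m + 1) (iY m j) (iZ m i) k =
    -(if i = j then (if k = iW m then 1 else 0) else 0) := by
  rw [sc_anti, sc_ZY]
lemma sc_WY : structC (m + 1) (iW m) (iY m i) k = 0 := by rw [sc_anti, sc_YW, neg_zero]
lemma sc_WZ : structC (m + 1) (iW m) (iZ m i) k = 0 := by rw [sc_anti, sc_ZW, neg_zero]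

variable (u v : Fin (2 * (m + 1)) → ℝ)

lemma bracket_eq : bracket (m + 1) u v k =
    (∑ i, (if k = iY m i then (u (iX m) * v (iY m i) - v (iX m) * u (iY m i)) / 2 else 0))
    + (∑ i, (if k = iZ m i then (u (iX m) * v (iZ m i) - v (iX m) * u (iZ m i)) / 2 else 0))
    + (if k = iW m then u (iX m) * v (iW m) - v (iX m) * u (iW m)
        + ∑ i, (u (iZ m i) * v (iY m i) - v (iZ m i) * u (iY m i)) else 0) := by
  have hd : ∀ (f : Fin m → Fin m → ℝ), ∑ i, ∑ j, (if i = j then f i j else 0) = ∑ i, f i i := by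
    intro f; simp
  have hd' : ∀ (f : Fin m → Fin m → ℝ), ∑ i, ∑ j, (if j = i then f i j else 0) = ∑ i, f i i := by
    intro f; simp
  simp only [bracket, idx_sum, sc_XX, sc_XY, sc_XZ, sc_XW, sc_YX, sc_YY, sc_YZ, sc_YW, sc_ZX,
    sc_ZY, sc_ZZ, sc_ZW, sc_WX, sc_WY, sc_WZ, sc_WW, mul_zero, Finset.sum_const_zero, add_zero,
    zero_add, Finset.sum_add_distrib, mul_neg, Finset.sum_neg_distrib, mul_ite, hd, hd']
  split_ifs with h
  · subst h
    simp only [iW_ne_iY, iW_ne_iZ, if_false, Finset.sum_const_zero, Finset.sum_sub_distrib,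
      mul_comm (v _)]
    ring_nf
  · simp only [Finset.sum_const_zero, neg_zero, add_zero]
    have e1 : ∀ (g : Fin m → Fin (2 * (m + 1))),
        ∑ i, (if k = g i then (u (iX m) * v (g i) - v (iX m) * u (g i)) / 2 else 0)
        = ∑ i, (if k = g i then u (iX m) * v (g i) * (1 / 2) else 0)
          - ∑ i, (if k = g i then u (g i) * v (iX m) * (1 / 2) else 0) := by
      intro g
      rw [← Finset.sum_sub_distrib]
      refine Finset.sum_congr rfl fun i _ => ?_
      split_ifs <;> ring
    rw [e1, e1]
    ring

lemma bracket_X : bracket (m + 1) u v (iX m) = 0 := by simp [bracket_eq]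
lemma bracket_Y : bracket (m + 1) u v (iY m i) =
    (u (iX m) * v (iY m i) - v (iX m) * u (iY m i)) / 2 := by simp [bracket_eq]
lemma bracket_Z : bracket (m + 1) u v (iZ m i) =
    (u (iX m) * v (iZ m i) - v (iX m) * u (iZ m i)) / 2 := by simp [bracket_eq]
lemma bracket_W : bracket (m + 1) u v (iW m) = u (iX m) * v (iW m) - v (iX m) * u (iW m)
        + ∑ i, (u (iZ m i) * v (iY m i) - v (iZ m i) * u (iY m i)) := by simp [bracket_eq]

end structure_constants

section form
variable {m : ℕ} (p β : ℝ) (x σ : Fin m → ℝ) (i j : Fin m)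


lemma S_XX : (Sform (m + 1) p x σ β) (iX m) (iX m) = p := by
  simp only [Sform, iX, Fin.ext_iff]; grind
lemma S_XY : (Sform (m + 1) p x σ β) (iX m) (iY m j) = x j := by
  have := j.2
  simp only [Sform, iX, iY, Fin.ext_iff]; grind
lemma S_XZ : (Sform (m + 1) p x σ β) (iX m) (iZ m j) = 0 := by
  have := j.2
  simp only [Sform, iX, iZ, Fin.ext_iff]; grind
lemma S_XW : (Sform (m + 1) p x σ β) (iX m) (iW m) = 0 := by
  simp only [Sform, iX, iW, Fin.ext_iff]; grind
lemma S_YX : (Sform (m + 1) p x σ β) (iY m i) (iX m) = x i := by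
  have := i.2
  simp only [Sform, iY, iX, Fin.ext_iff]; grind
lemma S_YY : (Sform (m + 1) p x σ β) (iY m i) (iY m j) = if i = j then σ i else 0 := by
  have := i.2
  have := j.2
  simp only [Sform, iY, Fin.ext_iff]; grind
lemma S_YZ : (Sform (m + 1) p x σ β) (iY m i) (iZ m j) = 0 := by
  have := i.2
  have := j.2
  simp only [Sform, iY, iZ, Fin.ext_iff]; grind
lemma S_YW : (Sform (m + 1) p x σ β) (iY m i) (iW m) = 0 := by
  have := i.2
  simp only [Sform, iY, iW, Fin.ext_iff]; grind
lemma S_ZX : (Sform (m + 1) p x σ β) (iZ m i) (iX m) = 0 := by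
  have := i.2
  simp only [Sform, iZ, iX, Fin.ext_iff]; grind
lemma S_ZY : (Sform (m + 1) p x σ β) (iZ m i) (iY m j) = 0 := by
  have := i.2
  have := j.2
  simp only [Sform, iZ, iY, Fin.ext_iff]; grind
lemma S_ZZ : (Sform (m + 1) p x σ β) (iZ m i) (iZ m j) = if i = j then σ i else 0 := by
  have := i.2
  have := j.2
  simp only [Sform, iZ, Fin.ext_iff]; grind
lemma S_ZW : (Sform (m + 1) p x σ β) (iZ m i) (iW m) = 0 := by
  have := i.2
  simp only [Sform, iZ, iW, Fin.ext_iff]; grind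
lemma S_WX : (Sform (m + 1) p x σ β) (iW m) (iX m) = 0 := by
  simp only [Sform, iW, iX, Fin.ext_iff]; grind
lemma S_WY : (Sform (m + 1) p x σ β) (iW m) (iY m j) = 0 := by
  have := j.2
  simp only [Sform, iW, iY, Fin.ext_iff]; grind
lemma S_WZ : (Sform (m + 1) p x σ β) (iW m) (iZ m j) = 0 := by
  have := j.2
  simp only [Sform, iW, iZ, Fin.ext_iff]; grind
lemma S_WW : (Sform (m + 1) p x σ β) (iW m) (iW m) = β := by
  simp only [Sform, iW, Fin.ext_iff]; grind

lemma ip_eq (u w : Fin (2 * (m + 1)) → ℝ) : ip (m + 1) (Sform (m + 1) p x σ β) u w =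
    u (iX m) * p * w (iX m) + u (iX m) * ∑ i, x i * w (iY m i)
    + w (iX m) * ∑ i, x i * u (iY m i) + ∑ i, σ i * u (iY m i) * w (iY m i)
    + ∑ i, σ i * u (iZ m i) * w (iZ m i) + β * u (iW m) * w (iW m) := by
  simp only [ip, dotProduct, Matrix.mulVec, idx_sum, S_XX, S_XY, S_XZ, S_XW, S_YX, S_YY, S_YZ,
    S_YW, S_ZX, S_ZY, S_ZZ, S_ZW, S_WX, S_WY, S_WZ, S_WW, zero_mul, Finset.sum_const_zero,
    add_zero, zero_add, ite_mul, Finset.sum_ite_eq, Finset.mem_univ, if_true, mul_add,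
    Finset.sum_add_distrib, mul_zero, Finset.sum_const_zero]
  rw [Finset.mul_sum (a := w (iX m))]
  have e1 : ∑ i, u (iY m i) * (x i * w (iX m)) = ∑ i, w (iX m) * (x i * u (iY m i)) :=
    Finset.sum_congr rfl fun i _ => by ring
  have e2 : ∑ i, u (iY m i) * (σ i * w (iY m i)) = ∑ i, σ i * u (iY m i) * w (iY m i) :=
    Finset.sum_congr rfl fun i _ => by ring
  have e3 : ∑ i, u (iZ m i) * (σ i * w (iZ m i)) = ∑ i, σ i * u (iZ m i) * w (iZ m i) :=
    Finset.sum_congr rfl fun i _ => by ring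
  rw [e1, e2, e3]; ring
end form

/-- Vectors of the algebra in coordinates with respect to the orthogonal frame
`(X - ∑ v_i Y_i, Y, Z, W)`. -/
@[ext] structure V (m : ℕ) where
  a : ℝ
  y : Fin m → ℝ
  z : Fin m → ℝ
  w : ℝ

section model
variable {m : ℕ}

def brV (v : Fin m → ℝ) (U U' : V m) : V m where
  a := 0
  y := fun i => (U.a * U'.y i - U'.a * U.y i) / 2
  z := fun i => (U.a * U'.z i - U'.a * U.z i) / 2
  w := U.a * U'.w - U'.a * U.w
    + ∑ i, (v i * (U.a * U'.z i - U'.a * U.z i) + U.z i * U'.y i - U'.z i * U.y i)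

def ipV (ζ β : ℝ) (σ : Fin m → ℝ) (U U' : V m) : ℝ :=
  ζ * U.a * U'.a + β * U.w * U'.w + ∑ i, (σ i * U.y i * U'.y i + σ i * U.z i * U'.z i)

def nabV (ζ β : ℝ) (v σ : Fin m → ℝ) (U U' : V m) : V m where
  a := (2 * β * U.w * U'.w + ∑ i, (σ i * U.y i * U'.y i + σ i * U.z i * U'.z i
        + β * v i * (U.w * U'.z i + U'.w * U.z i))) / (2 * ζ)
  y := fun i => (- U'.a * U.y i - β / σ i * (U.w * U'.z i + U'.w * U.z i)) / 2
  z := fun i => (- U'.a * U.z i + β / σ i * (U.w * U'.y i + U'.w * U.y i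
        - v i * (U'.a * U.w + U.a * U'.w))) / 2
  w := (- 2 * U'.a * U.w
    + ∑ i, (v i * (U.a * U'.z i - U'.a * U.z i) + U.z i * U'.y i - U'.z i * U.y i)) / 2

def toV (v : Fin m → ℝ) (u : Fin (2 * (m + 1)) → ℝ) : V m :=
  ⟨u (iX m), fun i => u (iY m i) + u (iX m) * v i, fun i => u (iZ m i), u (iW m)⟩

def ofV (v : Fin m → ℝ) (U : V m) : Fin (2 * (m + 1)) → ℝ := fun t =>
  (if t = iX m then U.a else 0) + (∑ i, if t = iY m i then U.y i - U.a * v i else 0)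
  + (∑ i, if t = iZ m i then U.z i else 0) + (if t = iW m then U.w else 0)

lemma toV_ofV (v : Fin m → ℝ) (U : V m) : toV v (ofV v U) = U := by
  ext <;> simp [toV, ofV]

lemma ofV_toV (v : Fin m → ℝ) (u : Fin (2 * (m + 1)) → ℝ) : ofV v (toV v u) = u := by
  ext t
  induction t using idx_cases_s7 <;> simp [toV, ofV]

lemma toV_inj (v : Fin m → ℝ) {u u' : Fin (2 * (m + 1)) → ℝ} (h : toV v u = toV v u') :
    u = u' := by
  rw [← ofV_toV v u, h, ofV_toV]

lemma toV_bracket (v : Fin m → ℝ) (u u' : Fin (2 * (m + 1)) → ℝ) :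
    toV v (bracket (m + 1) u u') = brV v (toV v u) (toV v u') := by
  ext
  · simp [toV, brV, bracket_X]
  · simp [toV, brV, bracket_X, bracket_Y]; ring
  · simp [toV, brV, bracket_Z]
  · simp only [toV, brV, bracket_W]
    congr 1
    exact Finset.sum_congr rfl fun i _ => by ring

lemma ip_toV (p β : ℝ) (x σ : Fin m → ℝ) (hσ : ∀ i, 0 < σ i) (u u' : Fin (2 * (m + 1)) → ℝ) :
    ip (m + 1) (Sform (m + 1) p x σ β) u u' =
    ipV (p - ∑ i, (x i) ^ 2 / σ i) β σ (toV (fun i => x i / σ i) u)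
      (toV (fun i => x i / σ i) u') := by
  rw [ip_eq]
  simp only [ipV, toV]
  have key : ∑ i, (σ i * (u (iY m i) + u (iX m) * (x i / σ i))
        * (u' (iY m i) + u' (iX m) * (x i / σ i)) + σ i * u (iZ m i) * u' (iZ m i))
      = u (iX m) * ∑ i, x i * u' (iY m i) + u' (iX m) * ∑ i, x i * u (iY m i)
        + ∑ i, σ i * u (iY m i) * u' (iY m i) + ∑ i, σ i * u (iZ m i) * u' (iZ m i)
        + u (iX m) * u' (iX m) * ∑ i, (x i) ^ 2 / σ i := by
    simp only [Finset.mul_sum, ← Finset.sum_add_distrib]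
    refine Finset.sum_congr rfl fun i _ => ?_
    have := (hσ i).ne'
    field_simp
    ring
  rw [key]; ring

lemma nabV_spec (ζ β : ℝ) (v σ : Fin m → ℝ) (hζ : 0 < ζ) (hσ : ∀ i, 0 < σ i) (U U' T : V m) :
    2 * ipV ζ β σ (nabV ζ β v σ U U') T = ipV ζ β σ (brV v U U') T - ipV ζ β σ (brV v U' T) U
      + ipV ζ β σ (brV v T U) U' := by
  simp only [ipV, nabV, brV]
  have e : ∀ s : ℝ, ζ * (s / (2 * ζ)) = s / 2 := fun s => by field_simp
  rw [e]
  have key := Finset.sum_eq_zero (s := Finset.univ) (f := fun i => 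
    T.a * (σ i * U.y i * U'.y i + σ i * U.z i * U'.z i
        + β * v i * (U.w * U'.z i + U'.w * U.z i))
    + 2 * (σ i * ((- U'.a * U.y i - β / σ i * (U.w * U'.z i + U'.w * U.z i)) / 2) * T.y i
      + σ i * ((- U'.a * U.z i + β / σ i * (U.w * U'.y i + U'.w * U.y i
        - v i * (U'.a * U.w + U.a * U'.w))) / 2) * T.z i)
    - (σ i * ((U.a * U'.y i - U'.a * U.y i) / 2) * T.y i
      + σ i * ((U.a * U'.z i - U'.a * U.z i) / 2) * T.z i)
    + (β * U.w * (v i * (U'.a * T.z i - T.a * U'.z i) + U'.z i * T.y i - T.z i * U'.y i)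
      + (σ i * ((U'.a * T.y i - T.a * U'.y i) / 2) * U.y i
      + σ i * ((U'.a * T.z i - T.a * U'.z i) / 2) * U.z i))
    - (β * U'.w * (v i * (T.a * U.z i - U.a * T.z i) + T.z i * U.y i - U.z i * T.y i)
      + (σ i * ((T.a * U.y i - U.a * T.y i) / 2) * U'.y i
      + σ i * ((T.a * U.z i - U.a * T.z i) / 2) * U'.z i)))
    (fun i _ => by
      have := (hσ i).ne'
      field_simp
      ring)
  rw [Finset.sum_sub_distrib, Finset.sum_add_distrib, Finset.sum_sub_distrib,
    Finset.sum_add_distrib, ← Finset.mul_sum, ← Finset.mul_sum, Finset.sum_add_distrib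
      (f := fun i => β * U.w * _), Finset.sum_add_distrib (f := fun i => β * U'.w * _),
      ← Finset.mul_sum,
    ← Finset.mul_sum] at key
  linear_combination key

lemma ipV_self (ζ β : ℝ) (σ : Fin m → ℝ) (hζ : 0 < ζ) (hβ : 0 < β) (hσ : ∀ i, 0 < σ i) (U : V m)
    (h : ipV ζ β σ U U = 0) : U = ⟨0, 0, 0, 0⟩ := by
  have h1 : 0 ≤ ζ * U.a * U.a := by
    rw [mul_assoc]; exact mul_nonneg hζ.le (mul_self_nonneg _)
  have h2 : 0 ≤ β * U.w * U.w := by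
    rw [mul_assoc]; exact mul_nonneg hβ.le (mul_self_nonneg _)
  have h3 : ∀ i, 0 ≤ σ i * U.y i * U.y i := fun i => by
    rw [mul_assoc]; exact mul_nonneg (hσ i).le (mul_self_nonneg _)
  have h4 : ∀ i, 0 ≤ σ i * U.z i * U.z i := fun i => by
    rw [mul_assoc]; exact mul_nonneg (hσ i).le (mul_self_nonneg _)
  have h5 : 0 ≤ ∑ i, (σ i * U.y i * U.y i + σ i * U.z i * U.z i) :=
    Finset.sum_nonneg fun i _ => add_nonneg (h3 i) (h4 i)
  unfold ipV at h
  have a1 : ζ * U.a * U.a = 0 := by linarith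
  have a2 : β * U.w * U.w = 0 := by linarith
  have a3 : ∑ i, (σ i * U.y i * U.y i + σ i * U.z i * U.z i) = 0 := by linarith
  rw [Finset.sum_eq_zero_iff_of_nonneg fun i _ => add_nonneg (h3 i) (h4 i)] at a3
  have a4 : ∀ i, σ i * U.y i * U.y i = 0 := fun i => by
    linarith [h3 i, h4 i, a3 i (Finset.mem_univ i)]
  have a5 : ∀ i, σ i * U.z i * U.z i = 0 := fun i => by
    linarith [h3 i, h4 i, a3 i (Finset.mem_univ i)]
  ext i
  · simpa [hζ.ne'] using a1
  · simpa [(hσ i).ne'] using a4 i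
  · simpa [(hσ i).ne'] using a5 i
  · simpa [hβ.ne'] using a2

lemma Sform_det (p β : ℝ) (x σ : Fin m → ℝ) (hβ : 0 < β) (hσ : ∀ i, 0 < σ i)
    (hz : 0 < p - ∑ i, (x i) ^ 2 / σ i) : IsUnit (Sform (m + 1) p x σ β).det := by
  rw [isUnit_iff_ne_zero]
  intro h
  obtain ⟨u, hu, hu'⟩ := Matrix.exists_mulVec_eq_zero_iff.2 h
  apply hu
  have h0 : ip (m + 1) (Sform (m + 1) p x σ β) u u = 0 := by simp [ip, hu']
  rw [ip_toV p β x σ hσ] at h0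
  have := ipV_self _ β σ hz hβ hσ _ h0
  apply toV_inj (fun i => x i / σ i)
  rw [this]
  ext <;> simp [toV]

lemma ipV_comm (ζ β : ℝ) (σ : Fin m → ℝ) (U U' : V m) : ipV ζ β σ U U' = ipV ζ β σ U' U := by
  unfold ipV
  congr 1
  · ring
  · exact Finset.sum_congr rfl fun i _ => by ring

lemma toV_nabla (p β : ℝ) (x σ : Fin m → ℝ) (hβ : 0 < β) (hσ : ∀ i, 0 < σ i)
    (hz : 0 < p - ∑ i, (x i) ^ 2 / σ i) (u u' : Fin (2 * (m + 1)) → ℝ) :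
    toV (fun i => x i / σ i) (nabla (m + 1) (Sform (m + 1) p x σ β) u u') =
    nabV (p - ∑ i, (x i) ^ 2 / σ i) β (fun i => x i / σ i) σ (toV (fun i => x i / σ i) u)
      (toV (fun i => x i / σ i) u') := by
  set v : Fin m → ℝ := fun i => x i / σ i with hv
  set ζ := p - ∑ i, (x i) ^ 2 / σ i with hζ
  set N := nabV ζ β v σ (toV v u) (toV v u') with hN
  have hk : koszul (m + 1) (Sform (m + 1) p x σ β) u u' =
      (Sform (m + 1) p x σ β).mulVec ((2 : ℝ) • ofV v N) := by
    ext t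
    have e : (Sform (m + 1) p x σ β).mulVec ((2 : ℝ) • ofV v N) t
        = 2 * ip (m + 1) (Sform (m + 1) p x σ β) (Pi.single t 1) (ofV v N) := by
      simp [ip, Matrix.mulVec_smul]
    rw [e]
    unfold koszul
    simp only [ip_toV p β x σ hσ, toV_bracket, toV_ofV, ← hv, ← hζ]
    rw [ipV_comm ζ β σ _ N, hN, nabV_spec ζ β v σ hz hσ]
  unfold nabla
  rw [hk, Matrix.mulVec_mulVec, Matrix.nonsing_inv_mul _ (Sform_det p β x σ hβ hσ hz),
    Matrix.one_mulVec, smul_smul]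
  norm_num [toV_ofV]
end model

section ricci_model
variable {m : ℕ}

def comb (T : V m) (c : ℝ) (T' : V m) : V m :=
  ⟨T.a + c * T'.a, fun i => T.y i + c * T'.y i, fun i => T.z i + c * T'.z i, T.w + c * T'.w⟩

lemma sum_comb (f g h : Fin m → ℝ) (c : ℝ) (H : ∀ i, f i = g i + c * h i) :
    ∑ i, f i = ∑ i, g i + c * ∑ i, h i := by
  rw [Finset.mul_sum, ← Finset.sum_add_distrib]
  exact Finset.sum_congr rfl fun i _ => H i

lemma nabV_comb_left (ζ β : ℝ) (v σ : Fin m → ℝ) (T T' U : V m) (c : ℝ) :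
    nabV ζ β v σ (comb T c T') U = comb (nabV ζ β v σ T U) c (nabV ζ β v σ T' U) := by
  ext i
  · simp only [nabV, comb]
    rw [sum_comb _ _ _ c fun i => ?_]
    rotate_left 3
    · show _ = (σ i * T.y i * U.y i + σ i * T.z i * U.z i + β * v i * (T.w * U.z i + U.w * T.z i))
        + c * (σ i * T'.y i * U.y i + σ i * T'.z i * U.z i
          + β * v i * (T'.w * U.z i + U.w * T'.z i))
      ring
    ring
  · simp only [nabV, comb]; ring
  · simp only [nabV, comb]; ring
  · simp only [nabV, comb]
    rw [sum_comb _ _ _ c fun i => ?_]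
    rotate_left 3
    · show _ = (v i * (T.a * U.z i - U.a * T.z i) + T.z i * U.y i - U.z i * T.y i)
        + c * (v i * (T'.a * U.z i - U.a * T'.z i) + T'.z i * U.y i - U.z i * T'.y i)
      ring
    ring

lemma nabV_comb_right (ζ β : ℝ) (v σ : Fin m → ℝ) (T T' U : V m) (c : ℝ) :
    nabV ζ β v σ U (comb T c T') = comb (nabV ζ β v σ U T) c (nabV ζ β v σ U T') := by
  ext i
  · simp only [nabV, comb]
    rw [sum_comb _ _ _ c fun i => ?_]
    rotate_left 3
    · show _ = (σ i * U.y i * T.y i + σ i * U.z i * T.z i + β * v i * (U.w * T.z i + T.w * U.z i))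
        + c * (σ i * U.y i * T'.y i + σ i * U.z i * T'.z i
          + β * v i * (U.w * T'.z i + T'.w * U.z i))
      ring
    ring
  · simp only [nabV, comb]; ring
  · simp only [nabV, comb]; ring
  · simp only [nabV, comb]
    rw [sum_comb _ _ _ c fun i => ?_]
    rotate_left 3
    · show _ = (v i * (U.a * T.z i - T.a * U.z i) + U.z i * T.y i - T.z i * U.y i)
        + c * (v i * (U.a * T'.z i - T'.a * U.z i) + U.z i * T'.y i - T'.z i * U.y i)
      ring
    ring

lemma brV_comb_left (v : Fin m → ℝ) (T T' U : V m) (c : ℝ) :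
    brV v (comb T c T') U = comb (brV v T U) c (brV v T' U) := by
  ext i
  · simp only [brV, comb]; ring
  · simp only [brV, comb]; ring
  · simp only [brV, comb]; ring
  · simp only [brV, comb]
    rw [sum_comb _ _ _ c fun i => ?_]
    rotate_left 3
    · show _ = (v i * (T.a * U.z i - U.a * T.z i) + T.z i * U.y i - U.z i * T.y i)
        + c * (v i * (T'.a * U.z i - U.a * T'.z i) + T'.z i * U.y i - U.z i * T'.y i)
      ring
    ring

def eE : V m := ⟨1, 0, 0, 0⟩
def eY (i : Fin m) : V m := ⟨0, Pi.single i 1, 0, 0⟩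
def eZ (i : Fin m) : V m := ⟨0, 0, Pi.single i 1, 0⟩
def eW : V m := ⟨0, 0, 0, 1⟩

lemma lin_expand (f : V m → ℝ) (hf : ∀ T c T', f (comb T c T') = f T + c * f T') (v : Fin m → ℝ) :
    f ⟨1, v, 0, 0⟩ = f eE + ∑ i, v i * f (eY i) := by
  have key : ∀ s : Finset (Fin m), f ⟨1, fun j => if j ∈ s then v j else 0, 0, 0⟩
      = f eE + ∑ i ∈ s, v i * f (eY i) := by
    intro s
    induction s using Finset.induction_on with
    | empty => simp [eE]; rfl
    | insert i s hi ih =>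
      rw [Finset.sum_insert hi, add_left_comm, ← ih, add_comm, ← hf]
      congr 1
      ext j
      · simp [comb, eY]
      · by_cases h : j = i
        · subst h; simp [comb, eY, hi]
        · simp [comb, eY, h]
      · simp [comb, eY]
      · simp [comb, eY]
  simpa using key Finset.univ

lemma tr_nabV (ζ β : ℝ) (v σ : Fin m → ℝ) (N : V m) :
    (nabV ζ β v σ eE N).a + ∑ i, (nabV ζ β v σ (eY i) N).y i + ∑ i, (nabV ζ β v σ (eZ i) N).z i
      + (nabV ζ β v σ eW N).w = -((m : ℝ) + 1) * N.a := by
  simp [nabV, eE, eY, eZ, eW]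
  ring

lemma sum_single (i : Fin m) (g : Fin m → ℝ) : ∑ j, g j * (Pi.single i 1 : Fin m → ℝ) j = g i := by
  simp [Pi.single_apply]

lemma nab_eE (ζ β : ℝ) (v σ : Fin m → ℝ) (U : V m) : nabV ζ β v σ eE U =
    ⟨0, 0, fun i => -(β / σ i * (v i * U.w)) / 2, (∑ i, v i * U.z i) / 2⟩ := by
  ext <;> simp [nabV, eE]

lemma nab_eY (ζ β : ℝ) (v σ : Fin m → ℝ) (U : V m) (i : Fin m) : nabV ζ β v σ (eY i) U =
    ⟨σ i * U.y i / (2 * ζ), Pi.single i (-U.a / 2), Pi.single i (β / σ i * U.w / 2),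
      -U.z i / 2⟩ := by
  ext j
  · simp [nabV, eY, Pi.single_apply]
  · by_cases h : j = i
    · subst h; simp [nabV, eY]
    · simp [nabV, eY, h]
  · by_cases h : j = i
    · subst h; simp [nabV, eY]
    · simp [nabV, eY, h]
  · simp [nabV, eY, Pi.single_apply]

lemma nab_eZ (ζ β : ℝ) (v σ : Fin m → ℝ) (U : V m) (i : Fin m) : nabV ζ β v σ (eZ i) U =
    ⟨(σ i * U.z i + β * v i * U.w) / (2 * ζ), Pi.single i (-(β / σ i * U.w) / 2),
      Pi.single i (-U.a / 2), (U.y i - v i * U.a) / 2⟩ := by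
  ext j
  · simp [nabV, eZ, Pi.single_apply, Finset.sum_add_distrib]
  · by_cases h : j = i
    · subst h; simp [nabV, eZ]
    · simp [nabV, eZ, h]
  · by_cases h : j = i
    · subst h; simp [nabV, eZ]
    · simp [nabV, eZ, h]
  · simp [nabV, eZ, Pi.single_apply, Finset.sum_add_distrib]; ring

lemma nab_eW (ζ β : ℝ) (v σ : Fin m → ℝ) (U : V m) : nabV ζ β v σ eW U =
    ⟨(2 * β * U.w + β * ∑ i, v i * U.z i) / (2 * ζ), fun i => -(β / σ i * U.z i) / 2,
      fun i => β / σ i * (U.y i - v i * U.a) / 2, -U.a⟩ := by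
  ext j
  · simp [nabV, eW, Finset.mul_sum, mul_assoc]
  · simp [nabV, eW]
  · simp [nabV, eW]
  · simp [nabV, eW]; ring

lemma br_eE (v : Fin m → ℝ) (U : V m) : brV v eE U =
    ⟨0, fun i => U.y i / 2, fun i => U.z i / 2, U.w + ∑ i, v i * U.z i⟩ := by
  ext <;> simp [brV, eE]

lemma br_eY (v : Fin m → ℝ) (U : V m) (i : Fin m) : brV v (eY i) U =
    ⟨0, Pi.single i (-U.a / 2), 0, -U.z i⟩ := by
  ext j
  · simp [brV, eY]
  · by_cases h : j = i
    · subst h; simp [brV, eY]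
    · simp [brV, eY, h]
  · simp [brV, eY]
  · simp [brV, eY, Pi.single_apply]

lemma br_eZ (v : Fin m → ℝ) (U : V m) (i : Fin m) : brV v (eZ i) U =
    ⟨0, 0, Pi.single i (-U.a / 2), U.y i - v i * U.a⟩ := by
  ext j
  · simp [brV, eZ]
  · simp [brV, eZ]
  · by_cases h : j = i
    · subst h; simp [brV, eZ]
    · simp [brV, eZ, h]
  · simp [brV, eZ, Pi.single_apply, Finset.sum_add_distrib]; ring

lemma br_eW (v : Fin m → ℝ) (U : V m) : brV v eW U = ⟨0, 0, 0, -U.a⟩ := by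
  ext <;> simp [brV, eW]

lemma part_E (ζ β : ℝ) (v σ : Fin m → ℝ) (hζ : 0 < ζ) (hσ : ∀ i, 0 < σ i) (U U' : V m) :
    (nabV ζ β v σ U (nabV ζ β v σ eE U')).a + (nabV ζ β v σ (brV v eE U) U').a =
    (4 * β * U.w * U'.w + 4 * β * (U.w * (∑ i, v i * U'.z i) + U'.w * ∑ i, v i * U.z i)
      + 3 * β * (∑ i, v i * U.z i) * (∑ i, v i * U'.z i)
      - β ^ 2 * U.w * U'.w * (∑ i, v i ^ 2 / σ i)
      + ∑ i, (σ i * U.y i * U'.y i + σ i * U.z i * U'.z i)) / (4 * ζ) := by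
  rw [nab_eE, br_eE]
  generalize hP : ∑ i, v i * U.z i = P
  generalize hP' : ∑ i, v i * U'.z i = P'
  simp only [nabV]
  have e1 : ∑ i, (σ i * U.y i * (0 : Fin m → ℝ) i + σ i * U.z i * (-(β / σ i * (v i * U'.w)) / 2)
      + β * v i * (U.w * (-(β / σ i * (v i * U'.w)) / 2) + P' / 2 * U.z i))
      = - (β * U'.w / 2) * P - β ^ 2 * U.w * U'.w / 2 * (∑ i, v i ^ 2 / σ i) + β * P' / 2 * P := by
    rw [← hP]
    simp only [Finset.mul_sum, ← Finset.sum_add_distrib, ← Finset.sum_sub_distrib]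
    refine Finset.sum_congr rfl fun i _ => ?_
    have := (hσ i).ne'
    simp only [Pi.zero_apply]
    field_simp
    ring
  have e2 : ∀ c : ℝ, ∑ i, (σ i * (U.y i / 2) * U'.y i + σ i * (U.z i / 2) * U'.z i
      + β * v i * (c * U'.z i + U'.w * (U.z i / 2)))
      = 1 / 2 * (∑ i, (σ i * U.y i * U'.y i + σ i * U.z i * U'.z i)) + β * c * P'
        + β * U'.w / 2 * P := by
    intro c
    rw [← hP', ← hP]
    simp only [Finset.mul_sum, ← Finset.sum_add_distrib]
    refine Finset.sum_congr rfl fun i _ => ?_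
    ring
  rw [e1, e2]
  field_simp
  ring

lemma part_Y (ζ β : ℝ) (v σ : Fin m → ℝ) (hζ : 0 < ζ) (hσ : ∀ i, 0 < σ i) (U U' : V m)
    (i : Fin m) :
    (nabV ζ β v σ U (nabV ζ β v σ (eY i) U')).y i + (nabV ζ β v σ (brV v (eY i) U) U').y i =
    - (σ i * U.y i * U'.y i) / (4 * ζ) - β ^ 2 * U.w * U'.w / 4 * (1 / σ i ^ 2)
      + 3 / 4 * β * (U.z i * U'.z i / σ i) + 1 / 4 * U.a * U'.a := by
  rw [nab_eY, br_eY]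
  have := (hσ i).ne'
  simp only [nabV, Pi.single_eq_same, Pi.zero_apply]
  field_simp
  ring

lemma part_Z (ζ β : ℝ) (v σ : Fin m → ℝ) (hζ : 0 < ζ) (hσ : ∀ i, 0 < σ i) (U U' : V m)
    (i : Fin m) :
    (nabV ζ β v σ U (nabV ζ β v σ (eZ i) U')).z i + (nabV ζ β v σ (brV v (eZ i) U) U').z i =
    - (σ i * U.z i * U'.z i) / (4 * ζ)
      - β * U'.w / (4 * ζ) * (v i * U.z i) - β * U.w / (4 * ζ) * (v i * U'.z i)
      - β ^ 2 * U.w * U'.w / (4 * ζ) * (v i ^ 2 / σ i)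
      - β ^ 2 * U.w * U'.w / 4 * (1 / σ i ^ 2)
      + 3 / 4 * β * ((U.y i - U.a * v i) * (U'.y i - U'.a * v i) / σ i) + 1 / 4 * U.a * U'.a := by
  rw [nab_eZ, br_eZ]
  have := (hσ i).ne'
  simp only [nabV, Pi.single_eq_same, Pi.zero_apply]
  field_simp
  ring

lemma part_W (ζ β : ℝ) (v σ : Fin m → ℝ) (hζ : 0 < ζ) (hσ : ∀ i, 0 < σ i) (U U' : V m) :
    (nabV ζ β v σ U (nabV ζ β v σ eW U')).w + (nabV ζ β v σ (brV v eW U) U').w =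
    - β * (2 * U.w + ∑ i, v i * U.z i) * (2 * U'.w + ∑ i, v i * U'.z i) / (4 * ζ)
    - β / 4 * (∑ i, (U.y i - U.a * v i) * (U'.y i - U'.a * v i) / σ i)
    - β / 4 * (∑ i, U.z i * U'.z i / σ i) + U.a * U'.a := by
  rw [nab_eW, br_eW]
  generalize hP' : ∑ i, v i * U'.z i = P'
  simp only [nabV]
  have e1 : ∑ i, (v i * (U.a * (β / σ i * (U'.y i - v i * U'.a) / 2)
      - (2 * β * U'.w + β * P') / (2 * ζ) * U.z i)
      + U.z i * (-(β / σ i * U'.z i) / 2) - β / σ i * (U'.y i - v i * U'.a) / 2 * U.y i)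
      = - (β / 2) * (∑ i, (U.y i - U.a * v i) * (U'.y i - U'.a * v i) / σ i)
        - β / 2 * (∑ i, U.z i * U'.z i / σ i)
        - (2 * β * U'.w + β * P') / (2 * ζ) * (∑ i, v i * U.z i) := by
    simp only [Finset.mul_sum, ← Finset.sum_add_distrib, ← Finset.sum_sub_distrib]
    refine Finset.sum_congr rfl fun i _ => ?_
    have := (hσ i).ne'
    field_simp
    ring
  rw [e1]
  simp only [Pi.zero_apply, zero_mul, mul_zero, sub_self, add_zero, Finset.sum_const_zero]
  generalize (∑ i, (U.y i - U.a * v i) * (U'.y i - U'.a * v i) / σ i) = Q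
  field_simp
  ring

def ricV (ζ β : ℝ) (v σ : Fin m → ℝ) (U U' : V m) : ℝ :=
  -(1 / (2 * ζ)) * (2 * (m + 1) * β * U.w * U'.w + (m + 2) * ζ * U.a * U'.a
    + (m + 1) * (∑ i, (σ i * U.y i * U'.y i + σ i * U.z i * U'.z i))
    + (2 * (m + 1) + 1) * (β / 2) * (U.w * (∑ i, v i * U'.z i) + U'.w * ∑ i, v i * U.z i)
    + β * (∑ i, v i * U.z i) * (∑ i, v i * U'.z i)
    - β ^ 2 * U.w * U'.w * (∑ i, v i ^ 2 / σ i)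
    + ζ * (- β ^ 2 * U.w * U'.w * (∑ i, 1 / σ i ^ 2) + β * (∑ i, U.z i * U'.z i / σ i)
      + β * (∑ i, (U.y i - U.a * v i) * (U'.y i - U'.a * v i) / σ i)))

/-- Components of the curvature operator applied to the third argument. -/
def cA (ζ β : ℝ) (v σ : Fin m → ℝ) (U U' T : V m) : ℝ :=
  (nabV ζ β v σ T (nabV ζ β v σ U U')).a - (nabV ζ β v σ U (nabV ζ β v σ T U')).a
    - (nabV ζ β v σ (brV v T U) U').a
def cY (ζ β : ℝ) (v σ : Fin m → ℝ) (U U' T : V m) (i : Fin m) : ℝ :=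
  (nabV ζ β v σ T (nabV ζ β v σ U U')).y i - (nabV ζ β v σ U (nabV ζ β v σ T U')).y i
    - (nabV ζ β v σ (brV v T U) U').y i
def cZ (ζ β : ℝ) (v σ : Fin m → ℝ) (U U' T : V m) (i : Fin m) : ℝ :=
  (nabV ζ β v σ T (nabV ζ β v σ U U')).z i - (nabV ζ β v σ U (nabV ζ β v σ T U')).z i
    - (nabV ζ β v σ (brV v T U) U').z i
def cW (ζ β : ℝ) (v σ : Fin m → ℝ) (U U' T : V m) : ℝ :=
  (nabV ζ β v σ T (nabV ζ β v σ U U')).w - (nabV ζ β v σ U (nabV ζ β v σ T U')).w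
    - (nabV ζ β v σ (brV v T U) U').w

lemma tr_curv (ζ β : ℝ) (v σ : Fin m → ℝ) (hζ : 0 < ζ) (hσ : ∀ i, 0 < σ i) (U U' : V m) :
    cA ζ β v σ U U' eE + ∑ i, cY ζ β v σ U U' (eY i) i + ∑ i, cZ ζ β v σ U U' (eZ i) i
      + cW ζ β v σ U U' eW = ricV ζ β v σ U U' := by
  have hY : ∑ i, cY ζ β v σ U U' (eY i) i
      = ∑ i, (nabV ζ β v σ (eY i) (nabV ζ β v σ U U')).y i
        - ∑ i, (- (σ i * U.y i * U'.y i) / (4 * ζ) - β ^ 2 * U.w * U'.w / 4 * (1 / σ i ^ 2)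
      + 3 / 4 * β * (U.z i * U'.z i / σ i) + 1 / 4 * U.a * U'.a) := by
    rw [← Finset.sum_sub_distrib]
    refine Finset.sum_congr rfl fun i _ => ?_
    rw [← part_Y ζ β v σ hζ hσ U U' i, cY]; ring
  have hZ : ∑ i, cZ ζ β v σ U U' (eZ i) i
      = ∑ i, (nabV ζ β v σ (eZ i) (nabV ζ β v σ U U')).z i
        - ∑ i, (- (σ i * U.z i * U'.z i) / (4 * ζ)
      - β * U'.w / (4 * ζ) * (v i * U.z i) - β * U.w / (4 * ζ) * (v i * U'.z i)
      - β ^ 2 * U.w * U'.w / (4 * ζ) * (v i ^ 2 / σ i)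
      - β ^ 2 * U.w * U'.w / 4 * (1 / σ i ^ 2)
      + 3 / 4 * β * ((U.y i - U.a * v i) * (U'.y i - U'.a * v i) / σ i)
      + 1 / 4 * U.a * U'.a) := by
    rw [← Finset.sum_sub_distrib]
    refine Finset.sum_congr rfl fun i _ => ?_
    rw [← part_Z ζ β v σ hζ hσ U U' i, cZ]; ring
  have hE := part_E ζ β v σ hζ hσ U U'
  have hW := part_W ζ β v σ hζ hσ U U'
  have hT := tr_nabV ζ β v σ (nabV ζ β v σ U U')
  have hA : (nabV ζ β v σ U U').a = (2 * β * U.w * U'.w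
      + ∑ i, (σ i * U.y i * U'.y i + σ i * U.z i * U'.z i)
      + β * (U.w * (∑ i, v i * U'.z i) + U'.w * ∑ i, v i * U.z i)) / (2 * ζ) := by
    simp only [nabV]
    congr 1
    simp only [Finset.mul_sum, add_assoc, ← Finset.sum_add_distrib]
    congr 1
    exact Finset.sum_congr rfl fun i _ => by ring
  rw [hA] at hT
  rw [hY, hZ, cA, cW, ricV]
  simp only [Finset.sum_add_distrib, Finset.sum_sub_distrib, ← Finset.mul_sum, ← Finset.sum_div,
    Finset.sum_neg_distrib, Finset.sum_const, Finset.card_univ, Fintype.card_fin,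
    nsmul_eq_mul] at hE hW hT ⊢
  have hh : ζ * ζ⁻¹ = 1 := mul_inv_cancel₀ hζ.ne'
  linear_combination hT - hE - hW + (1 / 2 * β * (∑ i, U.z i * U'.z i / σ i)
    + 1 / 2 * β * (∑ i, (U.y i - U.a * v i) * (U'.y i - U'.a * v i) / σ i)
    - 1 / 2 * β ^ 2 * U.w * U'.w * (∑ i, 1 / σ i ^ 2) + U.a * U'.a * m / 2 + U.a * U'.a) * hh
end ricci_model

section final
variable {m : ℕ}

lemma toV_sX (v : Fin m → ℝ) : toV v (Pi.single (iX m) 1) = ⟨1, v, 0, 0⟩ := by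
  ext <;> simp [toV]
lemma toV_sY (v : Fin m → ℝ) (i : Fin m) : toV v (Pi.single (iY m i) 1) = eY i := by
  ext <;> simp [toV, eY, Pi.single_apply]
lemma toV_sZ (v : Fin m → ℝ) (i : Fin m) : toV v (Pi.single (iZ m i) 1) = eZ i := by
  ext <;> simp [toV, eZ, Pi.single_apply]
lemma toV_sW (v : Fin m → ℝ) : toV v (Pi.single (iW m) 1) = eW := by
  ext <;> simp [toV, eW]

lemma ricci_eq_ricV (p β : ℝ) (x σ : Fin m → ℝ) (hβ : 0 < β) (hσ : ∀ i, 0 < σ i)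
    (hz : 0 < p - ∑ i, (x i) ^ 2 / σ i) (u u' : Fin (2 * (m + 1)) → ℝ) :
    ricci (m + 1) (Sform (m + 1) p x σ β) u u' =
      ricV (p - ∑ i, (x i) ^ 2 / σ i) β (fun i => x i / σ i) σ (toV (fun i => x i / σ i) u)
        (toV (fun i => x i / σ i) u') := by
  set v : Fin m → ℝ := fun i => x i / σ i with hv
  set ζ := p - ∑ i, (x i) ^ 2 / σ i with hζ
  have hN : ∀ f g, toV v (nabla (m + 1) (Sform (m + 1) p x σ β) f g)
      = nabV ζ β v σ (toV v f) (toV v g) := fun f g => toV_nabla p β x σ hβ hσ hz f g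
  have hX : ∀ f : Fin (2 * (m + 1)) → ℝ, f (iX m) = (toV v f).a := fun f => rfl
  have hY : ∀ (f : Fin (2 * (m + 1)) → ℝ) i, f (iY m i) = (toV v f).y i - v i * (toV v f).a :=
    fun f i => by simp [toV]; ring
  have hZ : ∀ (f : Fin (2 * (m + 1)) → ℝ) i, f (iZ m i) = (toV v f).z i := fun f i => rfl
  have hW : ∀ f : Fin (2 * (m + 1)) → ℝ, f (iW m) = (toV v f).w := fun f => rfl
  rw [← tr_curv ζ β v σ hz hσ]
  unfold ricci
  rw [idx_sum]
  have cX : ∀ T, curv (m + 1) (Sform (m + 1) p x σ β) T u u' (iX m)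
      = cA ζ β v σ (toV v u) (toV v u') (toV v T) := by
    intro T
    simp only [curv, Pi.sub_apply]
    simp only [cA, hX, hN, toV_bracket]
  have cY' : ∀ T i, curv (m + 1) (Sform (m + 1) p x σ β) T u u' (iY m i)
      = cY ζ β v σ (toV v u) (toV v u') (toV v T) i
        - v i * cA ζ β v σ (toV v u) (toV v u') (toV v T) := by
    intro T i
    simp only [curv, Pi.sub_apply]
    simp only [cA, cY, hY, hN, toV_bracket]; ring
  have cZ' : ∀ T i, curv (m + 1) (Sform (m + 1) p x σ β) T u u' (iZ m i)
      = cZ ζ β v σ (toV v u) (toV v u') (toV v T) i := by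
    intro T i
    simp only [curv, Pi.sub_apply]
    simp only [cZ, hZ, hN, toV_bracket]
  have cW' : ∀ T, curv (m + 1) (Sform (m + 1) p x σ β) T u u' (iW m)
      = cW ζ β v σ (toV v u) (toV v u') (toV v T) := by
    intro T
    simp only [curv, Pi.sub_apply]
    simp only [cW, hW, hN, toV_bracket]
  simp only [cX, cY', cZ', cW', toV_sX, toV_sY, toV_sZ, toV_sW]
  rw [lin_expand (cA ζ β v σ (toV v u) (toV v u')) (fun T c T' => by
    simp only [cA, nabV_comb_left, nabV_comb_right, brV_comb_left]
    simp only [comb]; ring), Finset.sum_sub_distrib]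
  ring

section ricMat_values
variable (p β : ℝ) (x σ : Fin m → ℝ) (i j : Fin m)
lemma R_XX : ricMat (m + 1) p β x σ (iX m) (iX m) = -(1 / (2 * zval (m + 1) p x σ)) *
    (((m : ℝ) + 1) * p + zval (m + 1) p x σ) := by
  simp [ricMat, iX]
lemma R_XY : ricMat (m + 1) p β x σ (iX m) (iY m j) = -(1 / (2 * zval (m + 1) p x σ)) *
    (((m : ℝ) + 1) * x j) := by
  have := j.2
  simp only [ricMat, iX, iY, Fin.ext_iff, Nat.cast_add, Nat.cast_one]; congr 1; grind
lemma R_XZ : ricMat (m + 1) p β x σ (iX m) (iZ m j) = -(1 / (2 * zval (m + 1) p x σ)) *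
    (0) := by
  have := j.2
  simp only [ricMat, iX, iZ, Fin.ext_iff, Nat.cast_add, Nat.cast_one]; congr 1; grind
lemma R_XW : ricMat (m + 1) p β x σ (iX m) (iW m) = -(1 / (2 * zval (m + 1) p x σ)) *
    (0) := by
  simp only [ricMat, iX, iW, Fin.ext_iff, Nat.cast_add, Nat.cast_one]; congr 1; grind
lemma R_YX : ricMat (m + 1) p β x σ (iY m i) (iX m) = -(1 / (2 * zval (m + 1) p x σ)) *
    (((m : ℝ) + 1) * x i) := by
  have := i.2
  simp only [ricMat, iY, iX, Fin.ext_iff, Nat.cast_add, Nat.cast_one]; congr 1; grind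
lemma R_YY : ricMat (m + 1) p β x σ (iY m i) (iY m j) = -(1 / (2 * zval (m + 1) p x σ)) *
    (if i = j then ((m : ℝ) + 1) * σ i + β * zval (m + 1) p x σ / σ i else 0) := by
  have := i.2
  have := j.2
  simp only [ricMat, iY, Fin.ext_iff, Nat.cast_add, Nat.cast_one]; congr 1; grind
lemma R_YZ : ricMat (m + 1) p β x σ (iY m i) (iZ m j) = -(1 / (2 * zval (m + 1) p x σ)) *
    (0) := by
  have := i.2
  have := j.2
  simp only [ricMat, iY, iZ, Fin.ext_iff, Nat.cast_add, Nat.cast_one]; congr 1; grind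
lemma R_YW : ricMat (m + 1) p β x σ (iY m i) (iW m) = -(1 / (2 * zval (m + 1) p x σ)) *
    (0) := by
  have := i.2
  simp only [ricMat, iY, iW, Fin.ext_iff, Nat.cast_add, Nat.cast_one]; congr 1; grind
lemma R_ZX : ricMat (m + 1) p β x σ (iZ m i) (iX m) = -(1 / (2 * zval (m + 1) p x σ)) *
    (0) := by
  have := i.2
  simp only [ricMat, iZ, iX, Fin.ext_iff, Nat.cast_add, Nat.cast_one]; congr 1; grind
lemma R_ZY : ricMat (m + 1) p β x σ (iZ m i) (iY m j) = -(1 / (2 * zval (m + 1) p x σ)) *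
    (0) := by
  have := i.2
  have := j.2
  simp only [ricMat, iZ, iY, Fin.ext_iff, Nat.cast_add, Nat.cast_one]; congr 1; grind
lemma R_ZZ : ricMat (m + 1) p β x σ (iZ m i) (iZ m j) = -(1 / (2 * zval (m + 1) p x σ)) *
    ((if i = j then ((m : ℝ) + 1) * σ i + β * zval (m + 1) p x σ / σ i else 0)
      + β * (x i / σ i) * (x j / σ j)) := by
  have := i.2
  have := j.2
  simp only [ricMat, iZ, Fin.ext_iff, Nat.cast_add, Nat.cast_one]; congr 1; grind
lemma R_ZW : ricMat (m + 1) p β x σ (iZ m i) (iW m) = -(1 / (2 * zval (m + 1) p x σ)) *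
    ((2 * ((m : ℝ) + 1) + 1) * (β / 2) * (x i / σ i)) := by
  have := i.2
  simp only [ricMat, iZ, iW, Fin.ext_iff, Nat.cast_add, Nat.cast_one]; congr 1; grind
lemma R_WX : ricMat (m + 1) p β x σ (iW m) (iX m) = -(1 / (2 * zval (m + 1) p x σ)) *
    (0) := by
  simp only [ricMat, iW, iX, Fin.ext_iff, Nat.cast_add, Nat.cast_one]; congr 1; grind
lemma R_WY : ricMat (m + 1) p β x σ (iW m) (iY m j) = -(1 / (2 * zval (m + 1) p x σ)) *
    (0) := by
  have := j.2
  simp only [ricMat, iW, iY, Fin.ext_iff, Nat.cast_add, Nat.cast_one]; congr 1; grind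
lemma R_WZ : ricMat (m + 1) p β x σ (iW m) (iZ m j) = -(1 / (2 * zval (m + 1) p x σ)) *
    ((2 * ((m : ℝ) + 1) + 1) * (β / 2) * (x j / σ j)) := by
  have := j.2
  simp only [ricMat, iW, iZ, Fin.ext_iff, Nat.cast_add, Nat.cast_one]; congr 1; grind
lemma R_WW : ricMat (m + 1) p β x σ (iW m) (iW m) = -(1 / (2 * zval (m + 1) p x σ)) *
    (2 * ((m : ℝ) + 1) * β - β ^ 2 * ∑ k, (1 / (σ k) ^ 2) * ((x k) ^ 2 / σ k + zval (m + 1) p x σ)) := by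
  unfold ricMat
  rw [if_neg (by simp [iW]), dif_neg (by simp [iW]), dif_neg (by simp [iW]),
    dif_neg (by simp [iW]; try omega), dif_neg (by simp [iW]; try omega),
    dif_neg (by simp [iW]; try omega),
    dif_neg (by simp [iW]; try omega), if_pos (by simp [iW]; try omega)]
  push_cast
  rfl
end ricMat_values

lemma ricci_matrix_aux (p β : ℝ) (x σ : Fin m → ℝ) (hβ : 0 < β) (hσ : ∀ i, 0 < σ i)
    (hz : 0 < zval (m + 1) p x σ) (i j : Fin (2 * (m + 1))) :
    ricci (m + 1) (Sform (m + 1) p x σ β) (Pi.single i 1) (Pi.single j 1)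
      = ricMat (m + 1) p β x σ i j := by
  have hzv : zval (m + 1) p x σ = p - ∑ i, (x i) ^ 2 / σ i := rfl
  rw [ricci_eq_ricV p β x σ hβ hσ hz, ← hzv]
  have hx : ∀ i, σ i * (x i / σ i) = x i := fun i => by have := (hσ i).ne'; field_simp
  have hzz := hz.ne'
  have hp : ∑ i, x i * (x i / σ i) = p - zval (m + 1) p x σ := by
    rw [hzv, sub_sub_cancel]
    exact Finset.sum_congr rfl fun i _ => by ring
  have hw : ∑ k, (1 / (σ k) ^ 2) * ((x k) ^ 2 / σ k + zval (m + 1) p x σ)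
      = ∑ k, (x k / σ k) ^ 2 / σ k + zval (m + 1) p x σ * ∑ k, 1 / σ k ^ 2 := by
    rw [Finset.mul_sum, ← Finset.sum_add_distrib]
    refine Finset.sum_congr rfl fun k _ => ?_
    have := (hσ k).ne'
    field_simp
  induction i using idx_cases_s7 with
  | hX =>
    induction j using idx_cases_s7 with
    | hX =>
      rw [toV_sX, R_XX, ricV]
      congr 1
      simp [Pi.single_apply, hx, hp]
      try ring
    | hY j =>
      rw [toV_sX, toV_sY, R_XY, ricV]
      congr 1
      simp [eY, Pi.single_apply, hx, hp]
      try ring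
    | hZ j =>
      rw [toV_sX, toV_sZ, R_XZ, ricV]
      congr 1
      simp [eZ, Pi.single_apply, hx, hp]
      try ring
    | hW =>
      rw [toV_sX, toV_sW, R_XW, ricV]
      congr 1
      simp [eW, Pi.single_apply, hx, hp]
      try ring
  | hY i =>
    induction j using idx_cases_s7 with
    | hX =>
      rw [toV_sY, toV_sX, R_YX, ricV]
      congr 1
      simp [eY, Pi.single_apply, hx, hp]
      try ring
    | hY j =>
      rw [toV_sY, toV_sY, R_YY, ricV]
      congr 1
      by_cases h : i = j
      · subst h
        simp [eY, Pi.single_apply, ite_div]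
        try ring
      · simp [eY, Pi.single_apply, ite_div, h, Ne.symm h]
    | hZ j =>
      rw [toV_sY, toV_sZ, R_YZ, ricV]
      congr 1
      simp [eY, eZ, Pi.single_apply, hx, hp]
      try ring
    | hW =>
      rw [toV_sY, toV_sW, R_YW, ricV]
      congr 1
      simp [eW, eY, Pi.single_apply, hx, hp]
      try ring
  | hZ i =>
    induction j using idx_cases_s7 with
    | hX =>
      rw [toV_sZ, toV_sX, R_ZX, ricV]
      congr 1
      simp [eZ, Pi.single_apply, hx, hp]
      try ring
    | hY j =>
      rw [toV_sZ, toV_sY, R_ZY, ricV]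
      congr 1
      simp [eY, eZ, Pi.single_apply, hx, hp]
      try ring
    | hZ j =>
      rw [toV_sZ, toV_sZ, R_ZZ, ricV]
      congr 1
      by_cases h : i = j
      · subst h
        simp [eZ, Pi.single_apply, ite_div]
        try ring
      · simp [eZ, Pi.single_apply, ite_div, h, Ne.symm h]
    | hW =>
      rw [toV_sZ, toV_sW, R_ZW, ricV]
      congr 1
      simp [eW, eZ, Pi.single_apply, hx, hp]
      try ring
  | hW =>
    induction j using idx_cases_s7 with
    | hX =>
      rw [toV_sW, toV_sX, R_WX, ricV]
      congr 1
      simp [eW, Pi.single_apply, hx, hp]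
      try ring
    | hY j =>
      rw [toV_sW, toV_sY, R_WY, ricV]
      congr 1
      simp [eW, eY, Pi.single_apply, hx, hp]
      try ring
    | hZ j =>
      rw [toV_sW, toV_sZ, R_WZ, ricV]
      congr 1
      simp [eW, eZ, Pi.single_apply, hx, hp]
      try ring
    | hW =>
      rw [toV_sW, R_WW, ricV]
      congr 1
      rw [hw]
      simp [eW, ]
      ring
end final

/-- The matrix of the Ricci form of `g(p,x,σ,β)` in the ordered basis. -/
theorem ricci_matrix (n : ℕ) (hn : 2 ≤ n) (p β : ℝ) (x σ : Fin (n - 1) → ℝ)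
    (hadm : Admissible n p x σ β) (hz : 0 < zval n p x σ) :
    ∀ i j, ricci n (Sform n p x σ β) (Pi.single i 1) (Pi.single j 1)
      = ricMat n p β x σ i j := by
  obtain ⟨m, rfl⟩ : ∃ m, n = m + 1 := ⟨n - 1, by omega⟩
  obtain ⟨-, hβ, -, -, hσ, -⟩ := hadm
  intro i j
  exact ricci_matrix_aux p β x σ hβ (fun i => lt_of_lt_of_le one_pos (hσ i)) hz i j

end CHn
end
end
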